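/- Let f, g ∈ ℝ[x,y] form a pair with nowhere vanishing Jacobian determinant such that deg f = 5 and deg g = 6. Then the map (f,g): ℝ² → ℝ² is injective. -/

import Mathlib

open MvPolynomial

noncomputable def Jac (f g : MvPolynomial (Fin 2) ℝ) : MvPolynomial (Fin 2) ℝ :=
  pderiv 0 f * pderiv 1 g - pderiv 1 f * pderiv 0 g

namespace RealJacobian

open scoped Polynomial Topology
open Filter

/-- The bivariate polynomial function with coefficients `F j ∈ ℝ[x]` in front of `y ^ j`,
truncated at `y`-degree six. -/
noncomputable def bi (F : ℕ → ℝ[X]) (x y : ℝ) : ℝ :=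
  ∑ j ∈ Finset.range 7, (F j).eval x * y ^ j

/-- Coefficients of the partial derivative with respect to `x`. -/
noncomputable def dx (F : ℕ → ℝ[X]) (j : ℕ) : ℝ[X] := Polynomial.derivative (F j)

/-- Coefficients of the partial derivative with respect to `y`. -/
noncomputable def dy (F : ℕ → ℝ[X]) (j : ℕ) : ℝ[X] := Polynomial.C ((j : ℝ) + 1) * F (j + 1)

/-- The Jacobian determinant of `(bi F, bi G)`. -/
noncomputable def jac (F G : ℕ → ℝ[X]) (x y : ℝ) : ℝ :=
  bi (dx F) x y * bi (dy G) x y - bi (dy F) x y * bi (dx G) x y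

/-- The monomials `x ^ i * y ^ j` occurring in `F` satisfy `P i j`. -/
def Supp (F : ℕ → ℝ[X]) (P : ℕ → ℕ → Prop) : Prop := ∀ i j, (F j).coeff i ≠ 0 → P i j

/-- The part of `bi F` of weight `d` when `x` has weight `p` and `y` has weight `q`. -/
noncomputable def lead (F : ℕ → ℝ[X]) (p q d : ℤ) (x y : ℝ) : ℝ :=
  ∑ j ∈ Finset.range 7, ∑ i ∈ Finset.range 7,
    if p * i + q * j = d then (F j).coeff i * (x ^ i * y ^ j) else 0

variable {F G : ℕ → ℝ[X]}

lemma Supp.mono {P Q : ℕ → ℕ → Prop} (h : Supp F P) (hPQ : ∀ i j, P i j → Q i j) : Supp F Q :=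
  fun i j hij ↦ hPQ i j (h i j hij)

lemma Supp.and {P Q : ℕ → ℕ → Prop} (h : Supp F P) (h' : Supp F Q) :
    Supp F (fun i j ↦ P i j ∧ Q i j) :=
  fun i j hij ↦ ⟨h i j hij, h' i j hij⟩

lemma Supp.coeff_eq_zero {P : ℕ → ℕ → Prop} (h : Supp F P) {i j : ℕ} (hij : ¬ P i j) :
    (F j).coeff i = 0 :=
  not_not.mp fun h0 ↦ hij (h i j h0)

lemma Supp.natDegree_le {P : ℕ → ℕ → Prop} (h : Supp F P) {j n : ℕ} (hn : ∀ i, P i j → i ≤ n) :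
    (F j).natDegree ≤ n :=
  Polynomial.natDegree_le_iff_coeff_eq_zero.mpr fun i hi ↦
    h.coeff_eq_zero fun hP ↦ absurd (hn i hP) (by omega)

lemma Supp.eq_zero {P : ℕ → ℕ → Prop} (h : Supp F P) {j : ℕ} (hn : ∀ i, ¬ P i j) : F j = 0 := by
  ext i
  simpa using h.coeff_eq_zero (hn i)

lemma tendsto_lead_of_tendsto (hF : Supp F fun i j ↦ i + j ≤ 6) {p q d : ℤ}
    (hd : Supp F fun i j ↦ p * i + q * j ≤ d) {ι : Type*} {l : Filter ι} {t X Y : ι → ℝ}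
    (ht : Tendsto t l atTop) {x y : ℝ} (hX : Tendsto X l (𝓝 x)) (hY : Tendsto Y l (𝓝 y)) :
    Tendsto (fun n ↦ t n ^ (-d) * bi F (t n ^ p * X n) (t n ^ q * Y n)) l
      (𝓝 (lead F p q d x y)) := by
  have key : ∀ i j : ℕ, Tendsto
      (fun n ↦ t n ^ (p * i + q * j - d) * ((F j).coeff i * (X n ^ i * Y n ^ j))) l
      (𝓝 (if p * i + q * j = d then (F j).coeff i * (x ^ i * y ^ j) else 0)) := by
    intro i j
    have hXY : Tendsto (fun n ↦ (F j).coeff i * (X n ^ i * Y n ^ j)) l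
        (𝓝 ((F j).coeff i * (x ^ i * y ^ j))) := ((hX.pow i).mul (hY.pow j)).const_mul _
    by_cases hc : (F j).coeff i = 0
    · simpa [hc] using tendsto_const_nhds
    rcases (hd i j hc).lt_or_eq with h | h
    · rw [if_neg h.ne]
      have := ((tendsto_zpow_atTop_zero (𝕜 := ℝ) (n := p * i + q * j - d) (by omega)).comp ht).mul
        hXY
      simpa using this
    · simpa [h] using hXY
  have := tendsto_finsetSum (Finset.range 7) fun j _ ↦
    tendsto_finsetSum (Finset.range 7) fun i _ ↦ key i j
  refine this.congr' ?_
  filter_upwards [ht.eventually (eventually_gt_atTop 0)] with n ht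
  rw [bi, Finset.mul_sum]
  refine Finset.sum_congr rfl fun j _ ↦ ?_
  have hdeg : (F j).natDegree < 7 :=
    Nat.lt_succ_of_le (hF.natDegree_le fun i hi ↦ by omega)
  rw [Polynomial.eval_eq_sum_range' hdeg, Finset.sum_mul, Finset.mul_sum]
  refine Finset.sum_congr rfl fun i _ ↦ ?_
  rw [sub_eq_add_neg, zpow_add₀ ht.ne', zpow_add₀ ht.ne', zpow_mul, zpow_mul, mul_pow, mul_pow,
    zpow_natCast, zpow_natCast]
  ring

lemma tendsto_lead (hF : Supp F fun i j ↦ i + j ≤ 6) {p q d : ℤ}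
    (hd : Supp F fun i j ↦ p * i + q * j ≤ d) (x y : ℝ) :
    Tendsto (fun t : ℝ ↦ t ^ (-d) * bi F (t ^ p * x) (t ^ q * y)) atTop
      (𝓝 (lead F p q d x y)) :=
  tendsto_lead_of_tendsto hF hd tendsto_id tendsto_const_nhds tendsto_const_nhds

lemma Supp.dx {P : ℕ → ℕ → Prop} (h : Supp F P) : Supp (dx F) fun i j ↦ P (i + 1) j :=
  fun i j hij ↦ h _ _ fun h0 ↦ hij (by simp [RealJacobian.dx, Polynomial.coeff_derivative, h0])

lemma Supp.dy {P : ℕ → ℕ → Prop} (h : Supp F P) : Supp (dy F) fun i j ↦ P i (j + 1) :=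
  fun i j hij ↦ h _ _ fun h0 ↦ hij (by rw [RealJacobian.dy, Polynomial.coeff_C_mul, h0, mul_zero])

/-- The weighted leading part of the Jacobian of a pair with positive Jacobian is nonnegative. -/
theorem jac_lead_nonneg (hJ : ∀ x y, 0 < jac F G x y)
    (hF : Supp F fun i j ↦ i + j ≤ 6) (hG : Supp G fun i j ↦ i + j ≤ 6) (p q d e : ℤ)
    (hd : Supp F fun i j ↦ (i = 0 ∧ j = 0) ∨ p * i + q * j ≤ d)
    (he : Supp G fun i j ↦ (i = 0 ∧ j = 0) ∨ p * i + q * j ≤ e) (x y : ℝ) :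
    0 ≤ lead (dx F) p q (d - p) x y * lead (dy G) p q (e - q) x y
      - lead (dy F) p q (d - q) x y * lead (dx G) p q (e - p) x y := by
  have aux : ∀ {H : ℕ → ℝ[X]} {c : ℤ}, Supp H (fun i j ↦ i + j ≤ 6) →
      Supp H (fun i j ↦ (i = 0 ∧ j = 0) ∨ p * i + q * j ≤ c) →
      Tendsto (fun t : ℝ ↦ t ^ (-(c - p)) * bi (dx H) (t ^ p * x) (t ^ q * y)) atTop
        (𝓝 (lead (dx H) p q (c - p) x y)) ∧
      Tendsto (fun t : ℝ ↦ t ^ (-(c - q)) * bi (dy H) (t ^ p * x) (t ^ q * y)) atTop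
        (𝓝 (lead (dy H) p q (c - q) x y)) := by
    intro H c h6 hc
    refine ⟨tendsto_lead (h6.dx.mono fun i j h ↦ by omega) (hc.dx.mono fun i j h ↦ ?_) x y,
      tendsto_lead (h6.dy.mono fun i j h ↦ by omega) (hc.dy.mono fun i j h ↦ ?_) x y⟩
    · rcases h with h | h
      · omega
      · push_cast at h; linarith
    · rcases h with h | h
      · omega
      · push_cast at h; linarith
  have lim := ((aux hF hd).1.mul (aux hG he).2).sub ((aux hF hd).2.mul (aux hG he).1)
  refine ge_of_tendsto lim ?_
  filter_upwards [eventually_gt_atTop 0] with t ht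
  have h1 : t ^ (-(d - q)) * t ^ (-(e - p)) = t ^ (-(d - p)) * t ^ (-(e - q)) := by
    rw [← zpow_add₀ ht.ne', ← zpow_add₀ ht.ne']
    congr 1
    ring
  have h2 : 0 < t ^ (-(d - p)) * t ^ (-(e - q)) := by positivity
  have h3 := mul_pos h2 (hJ (t ^ p * x) (t ^ q * y))
  rw [jac] at h3
  linear_combination h3.le + bi (dy F) (t ^ p * x) (t ^ q * y) *
    bi (dx G) (t ^ p * x) (t ^ q * y) * h1

lemma bi_dy (hF : Supp F fun i j ↦ i + j ≤ 6) (x y : ℝ) :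
    bi (dy F) x y = ∑ j ∈ Finset.range 7, (F j).eval x * (j * y ^ (j - 1)) := by
  have h7 : F 7 = 0 := hF.eq_zero fun i ↦ by omega
  simp [bi, dy, Finset.sum_range_succ, h7]
  ring

lemma hasStrictFDerivAt_bi (hF : Supp F fun i j ↦ i + j ≤ 6) (P : ℝ × ℝ) :
    HasStrictFDerivAt (fun P : ℝ × ℝ ↦ bi F P.1 P.2)
      (bi (dx F) P.1 P.2 • ContinuousLinearMap.fst ℝ ℝ ℝ
        + bi (dy F) P.1 P.2 • ContinuousLinearMap.snd ℝ ℝ ℝ) P := by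
  have key : ∀ j ∈ Finset.range 7, HasStrictFDerivAt
      (fun P : ℝ × ℝ ↦ (F j).eval P.1 * P.2 ^ j)
      (((F j).derivative.eval P.1 * P.2 ^ j) • ContinuousLinearMap.fst ℝ ℝ ℝ
        + ((F j).eval P.1 * (j * P.2 ^ (j - 1))) • ContinuousLinearMap.snd ℝ ℝ ℝ) P := by
    intro j _
    have h1 : HasStrictFDerivAt (fun P : ℝ × ℝ ↦ (F j).eval P.1)
        ((F j).derivative.eval P.1 • ContinuousLinearMap.fst ℝ ℝ ℝ) P :=
      ((F j).hasStrictDerivAt P.1).comp_hasStrictFDerivAt P hasStrictFDerivAt_fst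
    have h2 : HasStrictFDerivAt (fun P : ℝ × ℝ ↦ P.2 ^ j)
        ((j * P.2 ^ (j - 1)) • ContinuousLinearMap.snd ℝ ℝ ℝ) P :=
      (hasStrictDerivAt_pow j P.2).comp_hasStrictFDerivAt P hasStrictFDerivAt_snd
    refine (h1.mul h2).congr_fderiv ?_
    ext <;> simp; ring
  have := HasStrictFDerivAt.fun_sum key
  rw [Finset.sum_add_distrib, ← Finset.sum_smul, ← Finset.sum_smul] at this
  rw [bi_dy hF]
  exact this

lemma continuous_bi (F : ℕ → ℝ[X]) : Continuous fun P : ℝ × ℝ ↦ bi F P.1 P.2 := by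
  unfold bi
  fun_prop

theorem injective_of_isProperMap {Φ : ℝ × ℝ → ℝ × ℝ} (hΦ : IsLocalHomeomorph Φ)
    (hp : IsProperMap Φ) : Function.Injective Φ := by
  have hcov : IsCoveringMap Φ := by
    rw [isCoveringMap_iff_isCoveringMapOn_univ]
    refine hp.isClosedMap.isCoveringMapOn_of_isLocalHomeomorphOn (fun x _ ↦ ?_)
      (fun x _ ↦ ?_)
    · have hc : IsCompact (Φ ⁻¹' {x}) := hp.isCompact_preimage isCompact_singleton
      refine hc.finite ?_
      have hsub : (Φ '' (Φ ⁻¹' {x})).Subsingleton :=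
        Set.subsingleton_singleton.anti (Set.image_preimage_subset _ _)
      exact hΦ.isLocalHomeomorphOn.isDiscrete_of_image hsub.isDiscrete
    · exact hΦ.isLocalHomeomorphOn x (by trivial)
  intro P Q hPQ
  obtain ⟨s, ⟨hs1, hs2⟩, -⟩ :=
    hcov.existsUnique_continuousMap_lifts (ContinuousMap.id (ℝ × ℝ)) (Φ P) P rfl
  have hs : s ∘ Φ = id := by
    refine hcov.eq_of_comp_eq (s.continuous.comp hΦ.continuous) continuous_id ?_ P (by simpa using hs1)
    rw [← Function.comp_assoc, hs2]
    rfl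
  have h1 := congrFun hs P
  have h2 := congrFun hs Q
  simp only [Function.comp_apply, id] at h1 h2
  rw [← h1, ← h2, hPQ]

theorem injective_of_isOpenMap {f g : ℝ → ℝ → ℝ} (hf : Continuous fun P : ℝ × ℝ ↦ f P.1 P.2)
    (hg : Continuous fun P : ℝ × ℝ ↦ g P.1 P.2)
    (ho : IsOpenMap fun P : ℝ × ℝ ↦ (f P.1 P.2, g P.1 P.2))
    (hmono : ∀ y, StrictMono fun x ↦ f x y) (hsurj : ∀ y, Function.Surjective fun x ↦ f x y) :
    Function.Injective fun P : ℝ × ℝ ↦ (f P.1 P.2, g P.1 P.2) := by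
  rintro ⟨x₁, y₁⟩ ⟨x₂, y₂⟩ h
  simp only [Prod.mk.injEq] at h
  obtain ⟨h1, h2⟩ := h
  choose ξ hξ using fun y ↦ hsurj y (f x₁ y₁)
  simp only at hξ
  have hcont : Continuous ξ := by
    rw [continuous_iff_continuousAt]
    intro y
    refine tendsto_order.mpr ⟨fun a ha ↦ ?_, fun a ha ↦ ?_⟩
    · have : f a y < f x₁ y₁ := by rw [← hξ y]; exact hmono y ha
      have hc : Continuous fun y ↦ f a y := hf.comp (Continuous.prodMk_right a)
      filter_upwards [hc.continuousAt.eventually_lt_const this] with z hz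
      rw [← hξ z] at hz
      exact (hmono z).lt_iff_lt.mp hz
    · have : f x₁ y₁ < f a y := by rw [← hξ y]; exact hmono y ha
      have hc : Continuous fun y ↦ f a y := hf.comp (Continuous.prodMk_right a)
      filter_upwards [hc.continuousAt.eventually_const_lt this] with z hz
      rw [← hξ z] at hz
      exact (hmono z).lt_iff_lt.mp hz
  have hunique : ∀ x y, f x y = f x₁ y₁ → x = ξ y := fun x y hxy ↦
    (hmono y).injective (by simp only [hxy, hξ])
  have hh : Continuous fun y ↦ g (ξ y) y := hg.comp (hcont.prodMk continuous_id)
  have noext : ∀ y, ¬ IsLocalExtr (fun y ↦ g (ξ y) y) y := by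
    intro y hy
    have hmap := (isOpenMap_iff_nhds_le.mp ho) (ξ y, y)
    simp only [hξ] at hmap
    have hvert : Tendsto (fun s : ℝ ↦ (f x₁ y₁, s)) (𝓝 (g (ξ y) y))
        (𝓝 (f x₁ y₁, g (ξ y) y)) := (Continuous.prodMk_right _).continuousAt
    rcases hy with hy | hy
    · have hU : Set.univ ×ˢ {z | g (ξ y) y ≤ g (ξ z) z} ∈ 𝓝 (ξ y, y) :=
        prod_mem_nhds univ_mem hy
      have := hvert (hmap (image_mem_map hU))
      have hev : ∀ᶠ s in 𝓝[Set.Iio (g (ξ y) y)] (g (ξ y) y), (f x₁ y₁, s) ∈ _ :=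
        mem_nhdsWithin_of_mem_nhds this
      obtain ⟨s, ⟨P, hP, hPs⟩, hs⟩ := (hev.and self_mem_nhdsWithin).exists
      simp only [Prod.mk.injEq] at hPs
      have := hunique _ _ hPs.1
      have h3 : g (ξ y) y ≤ g (ξ P.2) P.2 := hP.2
      rw [← this, hPs.2] at h3
      exact absurd hs (not_lt.mpr h3)
    · have hU : Set.univ ×ˢ {z | g (ξ z) z ≤ g (ξ y) y} ∈ 𝓝 (ξ y, y) :=
        prod_mem_nhds univ_mem hy
      have := hvert (hmap (image_mem_map hU))
      have hev : ∀ᶠ s in 𝓝[Set.Ioi (g (ξ y) y)] (g (ξ y) y), (f x₁ y₁, s) ∈ _ :=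
        mem_nhdsWithin_of_mem_nhds this
      obtain ⟨s, ⟨P, hP, hPs⟩, hs⟩ := (hev.and self_mem_nhdsWithin).exists
      simp only [Prod.mk.injEq] at hPs
      have := hunique _ _ hPs.1
      have h3 : g (ξ P.2) P.2 ≤ g (ξ y) y := hP.2
      rw [← this, hPs.2] at h3
      exact absurd hs (not_lt.mpr h3)
  have hy : y₁ = y₂ := by
    have e1 := hunique _ _ rfl
    have e2 := hunique _ _ h1.symm
    have e : g (ξ y₁) y₁ = g (ξ y₂) y₂ := by rw [← e1, ← e2]; exact h2
    by_contra hne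
    rcases lt_or_gt_of_ne hne with hlt | hlt
    · obtain ⟨c, -, hc⟩ := exists_isLocalExtr_Ioo hlt hh.continuousOn e
      exact noext c hc
    · obtain ⟨c, -, hc⟩ := exists_isLocalExtr_Ioo hlt hh.continuousOn e.symm
      exact noext c hc
  subst hy
  rw [hunique _ _ rfl, hunique _ _ h1.symm]

theorem isLocalHomeomorph_bi (hF : Supp F fun i j ↦ i + j ≤ 6) (hG : Supp G fun i j ↦ i + j ≤ 6)
    (hJ : ∀ x y, 0 < jac F G x y) :
    IsLocalHomeomorph fun P : ℝ × ℝ ↦ (bi F P.1 P.2, bi G P.1 P.2) := by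
  refine IsLocalHomeomorph.mk _ fun P ↦ ?_
  have h := (hasStrictFDerivAt_bi hF P).prodMk (hasStrictFDerivAt_bi hG P)
  have hJP := (hJ P.1 P.2).ne'
  set D := jac F G P.1 P.2 with hD
  rw [jac] at hD
  set a := bi (dx F) P.1 P.2
  set b := bi (dy F) P.1 P.2
  set c := bi (dx G) P.1 P.2
  set d := bi (dy G) P.1 P.2
  let e : (ℝ × ℝ) ≃L[ℝ] (ℝ × ℝ) := ContinuousLinearEquiv.equivOfInverse
    ((a • ContinuousLinearMap.fst ℝ ℝ ℝ + b • ContinuousLinearMap.snd ℝ ℝ ℝ).prod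
      (c • ContinuousLinearMap.fst ℝ ℝ ℝ + d • ContinuousLinearMap.snd ℝ ℝ ℝ))
    (((d / D) • ContinuousLinearMap.fst ℝ ℝ ℝ + (-b / D) • ContinuousLinearMap.snd ℝ ℝ ℝ).prod
      ((-c / D) • ContinuousLinearMap.fst ℝ ℝ ℝ + (a / D) • ContinuousLinearMap.snd ℝ ℝ ℝ))
    (by rintro ⟨x, y⟩
        ext <;> simp <;> field_simp <;> rw [hD] <;> ring)
    (by rintro ⟨x, y⟩
        ext <;> simp <;> field_simp <;> rw [hD] <;> ring)
  have h' : HasStrictFDerivAt (fun P : ℝ × ℝ ↦ (bi F P.1 P.2, bi G P.1 P.2))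
    (e : (ℝ × ℝ) →L[ℝ] (ℝ × ℝ)) P := h
  exact ⟨h'.toOpenPartialHomeomorph _, h'.mem_toOpenPartialHomeomorph_source, fun _ _ ↦ rfl⟩

/-- A pair with positive Jacobian whose weighted leading parts have no common nontrivial zero is
injective. -/
theorem injective_of_lead (hF : Supp F fun i j ↦ i + j ≤ 6) (hG : Supp G fun i j ↦ i + j ≤ 6)
    (hJ : ∀ x y, 0 < jac F G x y) {p q : ℕ} {d e : ℤ} (hp : 0 < p) (hq : 0 < q) (hd0 : 0 < d)
    (he0 : 0 < e) (hd : Supp F fun i j ↦ (p : ℤ) * i + q * j ≤ d)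
    (he : Supp G fun i j ↦ (p : ℤ) * i + q * j ≤ e)
    (h0 : ∀ x y, lead F p q d x y = 0 → lead G p q e x y = 0 → x = 0 ∧ y = 0) :
    Function.Injective fun P : ℝ × ℝ ↦ (bi F P.1 P.2, bi G P.1 P.2) := by
  have hcont : Continuous fun P : ℝ × ℝ ↦ (bi F P.1 P.2, bi G P.1 P.2) :=
    (continuous_bi F).prodMk (continuous_bi G)
  refine injective_of_isProperMap (isLocalHomeomorph_bi hF hG hJ) ?_
  rw [isProperMap_iff_isCompact_preimage]
  refine ⟨hcont, fun K hK ↦ ?_⟩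
  refine Metric.isCompact_of_isClosed_isBounded (hK.isClosed.preimage hcont) ?_
  by_contra hunb
  obtain ⟨C, hC⟩ := hK.isBounded.exists_norm_le
  have hex : ∀ n : ℕ, ∃ P : ℝ × ℝ, |bi F P.1 P.2| ≤ C ∧ |bi G P.1 P.2| ≤ C ∧ (n : ℝ) < ‖P‖ := by
    intro n
    by_contra! hcon
    refine hunb (isBounded_iff_forall_norm_le.mpr ⟨n, fun P hP ↦ ?_⟩)
    have := hC _ hP
    exact hcon P ((norm_fst_le (bi F P.1 P.2, bi G P.1 P.2)).trans this)
      ((norm_snd_le (bi F P.1 P.2, bi G P.1 P.2)).trans this)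
  choose P hPF hPG hPn using hex
  have hpr : (p : ℝ) ≠ 0 := by positivity
  have hqr : (q : ℝ) ≠ 0 := by positivity
  let t : ℕ → ℝ := fun n ↦ max (|(P n).1| ^ (1 / (p : ℝ))) (|(P n).2| ^ (1 / (q : ℝ)))
  have root : ∀ (r : ℕ) (a : ℝ), 0 < r → (|a| ^ (1 / (r : ℝ))) ^ r = |a| := by
    intro r a hr
    rw [one_div]
    exact Real.rpow_inv_natCast_pow (abs_nonneg a) hr.ne'
  have ht0 : ∀ n, 0 ≤ t n := fun n ↦ le_max_of_le_left (by positivity)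
  have htp : ∀ n, |(P n).1| ≤ t n ^ p := fun n ↦ by
    rw [← root p (P n).1 hp]
    exact pow_le_pow_left₀ (by positivity) (le_max_left _ _) _
  have htq : ∀ n, |(P n).2| ≤ t n ^ q := fun n ↦ by
    rw [← root q (P n).2 hq]
    exact pow_le_pow_left₀ (by positivity) (le_max_right _ _) _
  have ht : Tendsto t atTop atTop := by
    refine tendsto_atTop.mpr fun M ↦ ?_
    obtain ⟨N, hN⟩ := exists_nat_ge ((max M 1) ^ (p + q))
    filter_upwards [eventually_ge_atTop N] with n hn
    by_contra! hlt
    have h1 : t n ≤ max M 1 := hlt.le.trans (le_max_left _ _)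
    have h2 : (1 : ℝ) ≤ max M 1 := le_max_right _ _
    have h3 : ‖P n‖ ≤ (max M 1) ^ (p + q) := by
      rw [Prod.norm_def]
      refine max_le ?_ ?_
      · exact ((htp n).trans (pow_le_pow_left₀ (ht0 n) h1 _)).trans
          (pow_le_pow_right₀ h2 (by omega))
      · exact ((htq n).trans (pow_le_pow_left₀ (ht0 n) h1 _)).trans
          (pow_le_pow_right₀ h2 (by omega))
    have h4 : (N : ℝ) ≤ n := by exact_mod_cast hn
    linarith [hPn n]
  obtain ⟨N, hN⟩ := (ht.eventually (eventually_gt_atTop 0)).exists_forall_of_atTop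
  let Q : ℕ → ℝ × ℝ := fun n ↦ ((P (n + N)).1 / t (n + N) ^ p, (P (n + N)).2 / t (n + N) ^ q)
  have hQ : ∀ n, Q n ∈ Metric.sphere (0 : ℝ × ℝ) 1 := by
    intro n
    have htn := hN (n + N) (by omega)
    rw [mem_sphere_zero_iff_norm, Prod.norm_def]
    simp only [Q, norm_div, Real.norm_eq_abs]
    rw [abs_of_pos (pow_pos htn p), abs_of_pos (pow_pos htn q)]
    refine le_antisymm (max_le ((div_le_one (pow_pos htn p)).mpr (htp _))
      ((div_le_one (pow_pos htn q)).mpr (htq _))) ?_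
    rcases max_choice (|(P (n + N)).1| ^ (1 / (p : ℝ))) (|(P (n + N)).2| ^ (1 / (q : ℝ)))
      with h | h
    · refine le_max_of_le_left ?_
      rw [one_le_div (pow_pos htn p), show t (n + N) = _ from h, root p _ hp]
    · refine le_max_of_le_right ?_
      rw [one_le_div (pow_pos htn q), show t (n + N) = _ from h, root q _ hq]
  obtain ⟨R, hR, φ, hφ, hlim⟩ := (isCompact_sphere (0 : ℝ × ℝ) 1).tendsto_subseq hQ
  have ht' : Tendsto (fun n ↦ t (φ n + N)) atTop atTop :=
    ht.comp ((tendsto_add_atTop_nat N).comp hφ.tendsto_atTop)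
  have hX : Tendsto (fun n ↦ (Q (φ n)).1) atTop (𝓝 R.1) := (continuous_fst.tendsto R).comp hlim
  have hY : Tendsto (fun n ↦ (Q (φ n)).2) atTop (𝓝 R.2) := (continuous_snd.tendsto R).comp hlim
  have hlead : ∀ {H : ℕ → ℝ[X]} {c : ℤ}, (Supp H fun i j ↦ i + j ≤ 6) → 0 < c →
      (Supp H fun i j ↦ (p : ℤ) * i + q * j ≤ c) → (∀ n, |bi H (P n).1 (P n).2| ≤ C) →
      lead H p q c R.1 R.2 = 0 := by
    intro H c h6 hc hs hb
    have l1 := tendsto_lead_of_tendsto h6 hs ht' hX hY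
    have l2 : Tendsto (fun n ↦ t (φ n + N) ^ (-c) * bi H (t (φ n + N) ^ (p : ℤ) * (Q (φ n)).1)
        (t (φ n + N) ^ (q : ℤ) * (Q (φ n)).2)) atTop (𝓝 0) := by
      have hz : Tendsto (fun n ↦ t (φ n + N) ^ (-c) * C) atTop (𝓝 0) := by
        simpa using ((tendsto_zpow_atTop_zero (𝕜 := ℝ) (n := -c) (by omega)).comp ht').mul_const C
      refine squeeze_zero_norm (fun n ↦ ?_) hz
      have htn := hN (φ n + N) (by omega)
      rw [norm_mul, Real.norm_of_nonneg (zpow_nonneg htn.le _)]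
      refine mul_le_mul_of_nonneg_left ?_ (zpow_nonneg htn.le _)
      have := hb (φ n + N)
      rw [Real.norm_eq_abs]
      simp only [Q, zpow_natCast]
      rwa [mul_div_cancel₀ _ (pow_pos htn p).ne', mul_div_cancel₀ _ (pow_pos htn q).ne']
    exact tendsto_nhds_unique l1 l2
  obtain ⟨hx, hy⟩ := h0 R.1 R.2 (hlead hF hd0 hd hPF) (hlead hG he0 he hPG)
  rw [mem_sphere_zero_iff_norm, Prod.norm_def, hx, hy] at hR
  simp at hR

lemma tendsto_atTop_of_strictMono {r : ℝ[X]} (h : StrictMono fun x ↦ r.eval x) :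
    Tendsto (fun x ↦ r.eval x) atTop atTop := by
  have hdeg : 0 < r.degree := by
    by_contra! hle
    rw [Polynomial.eq_C_of_degree_le_zero hle] at h
    have := h (zero_lt_one (α := ℝ))
    simp at this
  have := r.abs_tendsto_atTop hdeg
  refine tendsto_atTop.mpr fun M ↦ ?_
  filter_upwards [tendsto_atTop.mp this (max M (|r.eval 0| + 1)), eventually_ge_atTop 0]
    with x hx hx0
  have h1 := h.monotone hx0
  have h2 := (le_max_left _ _).trans hx
  have h3 := (le_max_right _ _).trans hx
  rcases abs_cases (r.eval x) with h4 | h4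
  · linarith
  · have := neg_abs_le (r.eval 0)
    linarith

lemma surjective_of_strictMono {r : ℝ[X]} (h : StrictMono fun x ↦ r.eval x) :
    Function.Surjective fun x ↦ r.eval x := by
  refine r.continuous.surjective (tendsto_atTop_of_strictMono h) ?_
  have h' : StrictMono fun x ↦ (-r.comp (-Polynomial.X)).eval x := fun x y hxy ↦ by
    simpa using h (neg_lt_neg hxy)
  have := tendsto_neg_atTop_atBot.comp ((tendsto_atTop_of_strictMono h').comp tendsto_neg_atBot_atTop)
  refine this.congr fun x ↦ ?_
  simp

lemma strictMono_or_strictAnti_of_derivative {r : ℝ[X]} (h : ∀ x, r.derivative.eval x ≠ 0) :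
    (StrictMono fun x ↦ r.eval x) ∨ StrictAnti fun x ↦ r.eval x := by
  have hc : (∀ x, 0 < r.derivative.eval x) ∨ ∀ x, r.derivative.eval x < 0 := by
    by_contra! hcon
    obtain ⟨⟨a, ha⟩, b, hb⟩ := hcon
    obtain ⟨c, hc⟩ := mem_range_of_exists_le_of_exists_ge r.derivative.continuous ⟨a, ha⟩ ⟨b, hb⟩
    exact h c hc
  rcases hc with hc | hc
  · exact Or.inl (strictMono_of_deriv_pos fun x ↦ by simpa using hc x)
  · exact Or.inr (strictAnti_of_deriv_neg fun x ↦ by simpa using hc x)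

lemma surjective_of_derivative {r : ℝ[X]} (h : ∀ x, r.derivative.eval x ≠ 0) :
    Function.Surjective fun x ↦ r.eval x := by
  rcases strictMono_or_strictAnti_of_derivative h with h | h
  · exact surjective_of_strictMono h
  · have h' : StrictMono fun x ↦ (-r).eval x := fun x y hxy ↦ by simpa using h hxy
    intro c
    obtain ⟨x, hx⟩ := surjective_of_strictMono h' (-c)
    exact ⟨x, by simpa using hx⟩

/-- The map `P ↦ (F(P), G(P))` attached to a pair. -/
noncomputable def toMap (F G : ℕ → ℝ[X]) (P : ℝ × ℝ) : ℝ × ℝ := (bi F P.1 P.2, bi G P.1 P.2)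

theorem injective_of_homeomorph (ho : IsOpenMap (toMap F G)) (e : ℝ × ℝ ≃ₜ ℝ × ℝ)
    (hmono : (∀ y, StrictMono fun x ↦ bi F (e (x, y)).1 (e (x, y)).2) ∨
      ∀ y, StrictAnti fun x ↦ bi F (e (x, y)).1 (e (x, y)).2)
    (hsurj : ∀ y, Function.Surjective fun x ↦ bi F (e (x, y)).1 (e (x, y)).2) :
    Function.Injective (toMap F G) := by
  suffices h : Function.Injective (toMap F G ∘ e) by
    intro P Q hPQ
    have := @h (e.symm P) (e.symm Q) (by simpa using hPQ)
    exact e.symm.injective this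
  have hf : Continuous fun P : ℝ × ℝ ↦ bi F (e (P.1, P.2)).1 (e (P.1, P.2)).2 :=
    (continuous_bi F).comp e.continuous
  have hg : Continuous fun P : ℝ × ℝ ↦ bi G (e (P.1, P.2)).1 (e (P.1, P.2)).2 :=
    (continuous_bi G).comp e.continuous
  have ho' : IsOpenMap (toMap F G ∘ e) := ho.comp e.isOpenMap
  rcases hmono with hm | hm
  · exact injective_of_isOpenMap (f := fun x y ↦ bi F (e (x, y)).1 (e (x, y)).2)
      (g := fun x y ↦ bi G (e (x, y)).1 (e (x, y)).2) hf hg ho' hm hsurj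
  · let n : ℝ × ℝ ≃ₜ ℝ × ℝ := (Homeomorph.neg ℝ).prodCongr (Homeomorph.refl ℝ)
    have := injective_of_isOpenMap (f := fun x y ↦ -bi F (e (x, y)).1 (e (x, y)).2)
      (g := fun x y ↦ bi G (e (x, y)).1 (e (x, y)).2) hf.neg hg (n.isOpenMap.comp ho')
      (fun y x x' hx ↦ neg_lt_neg (hm y hx)) (fun y c ↦ by
        obtain ⟨x, hx⟩ := hsurj y (-c)
        exact ⟨x, by simp only at hx ⊢; rw [hx, neg_neg]⟩)
    intro P Q hPQ
    refine this ?_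
    simpa [toMap] using hPQ

/-- Translation of the `x`-coordinate. -/
noncomputable def shift (s : ℝ) (F : ℕ → ℝ[X]) (j : ℕ) : ℝ[X] := Polynomial.taylor s (F j)

lemma bi_shift (s x y : ℝ) : bi (shift s F) x y = bi F (x + s) y := by
  simp [bi, shift, Polynomial.taylor_eval]

lemma jac_shift (s x y : ℝ) : jac (shift s F) (shift s G) x y = jac F G (x + s) y := by
  have h1 : ∀ H : ℕ → ℝ[X], dx (shift s H) = shift s (dx H) := fun H ↦ by
    ext1 j
    simp [dx, shift, Polynomial.taylor_apply, Polynomial.derivative_comp]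
  have h2 : ∀ H : ℕ → ℝ[X], dy (shift s H) = shift s (dy H) := fun H ↦ by
    ext1 j
    exact (by rw [Polynomial.taylor_mul, Polynomial.taylor_C] :
      Polynomial.C ((j : ℝ) + 1) * Polynomial.taylor s (H (j + 1))
        = Polynomial.taylor s (Polynomial.C ((j : ℝ) + 1) * H (j + 1)))
  simp only [jac, h1, h2, bi_shift]

lemma Supp.shift {P : ℕ → ℕ → Prop} (h : Supp F P) (s : ℝ) (hP : ∀ i k j, P k j → i ≤ k → P i j) :
    Supp (shift s F) P := by
  intro i j hij
  rw [RealJacobian.shift, Polynomial.taylor_coeff] at hij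
  have hdeg : i ≤ (F j).natDegree := by
    by_contra! hlt
    rw [Polynomial.hasseDeriv_eq_zero_of_lt_natDegree _ _ hlt] at hij
    simp at hij
  have hne : F j ≠ 0 := by
    intro h0
    simp [h0] at hij
  exact hP i _ j (h _ j (Polynomial.leadingCoeff_ne_zero.mpr hne)) hdeg

lemma injective_of_shift (s : ℝ) (h : Function.Injective (toMap (shift s F) (shift s G))) :
    Function.Injective (toMap F G) := by
  intro P Q hPQ
  have := @h (P.1 - s, P.2) (Q.1 - s, Q.2) (by simpa [toMap, bi_shift] using hPQ)
  simp only [Prod.mk.injEq, sub_left_inj] at this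
  exact Prod.ext this.1 this.2

lemma coeff_shift_of_natDegree_le (s : ℝ) {j n : ℕ} (h : (F j).natDegree ≤ n) :
    (shift s F j).coeff n = (F j).coeff n := by
  rw [shift, Polynomial.taylor_coeff]
  rcases h.lt_or_eq with h | h
  · rw [Polynomial.hasseDeriv_eq_zero_of_lt_natDegree _ _ h,
      Polynomial.coeff_eq_zero_of_natDegree_lt h, Polynomial.eval_zero]
  · have : (Polynomial.hasseDeriv n (F j)).natDegree ≤ 0 := by
      have := Polynomial.natDegree_hasseDeriv_le (F j) n
      omega
    rw [Polynomial.eq_C_of_natDegree_le_zero this, Polynomial.eval_C,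
      Polynomial.hasseDeriv_coeff]
    simp

lemma Supp.erase {P : ℕ → ℕ → Prop} (h : Supp F P) {i j : ℕ} (h0 : (F j).coeff i = 0) :
    Supp F fun k l ↦ P k l ∧ ¬(k = i ∧ l = j) :=
  fun k l hkl ↦ ⟨h k l hkl, by rintro ⟨rfl, rfl⟩; exact hkl h0⟩

lemma quadratic_nonneg {A B C : ℝ} (h : ∀ z, 0 ≤ A + B * z + C * z ^ 2) : B ^ 2 ≤ 4 * A * C := by
  have := discrim_le_zero (a := C) (b := B) (c := A) fun z ↦ by linarith [h z, sq z]
  rw [discrim] at this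
  linarith

lemma isOpenMap_toMap (hF : Supp F fun i j ↦ i + j ≤ 6) (hG : Supp G fun i j ↦ i + j ≤ 6)
    (hJ : ∀ x y, 0 < jac F G x y) : IsOpenMap (toMap F G) :=
  (isLocalHomeomorph_bi hF hG hJ).isOpenMap

lemma coeff_dx (i j : ℕ) : (dx F j).coeff i = (F j).coeff (i + 1) * (i + 1) := by
  rw [dx, Polynomial.coeff_derivative]

lemma coeff_dy (i j : ℕ) : (dy F j).coeff i = (j + 1) * (F (j + 1)).coeff i := by
  rw [dy, Polynomial.coeff_C_mul]

lemma lead_dx_eq (hF : Supp F fun i j ↦ i + j ≤ 6) {p q d : ℤ} {S : Finset (ℕ × ℕ)}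
    (hS : ∀ s ∈ S, p * s.1 + q * s.2 = d)
    (hd : Supp F fun i j ↦ i = 0 ∧ j = 0 ∨ p * i + q * j < d ∨ (i, j) ∈ S) (x y : ℝ) :
    lead (dx F) p q (d - p) x y =
      ∑ s ∈ S, s.1 * (F s.2).coeff s.1 * (x ^ (s.1 - 1) * y ^ s.2) := by
  rw [lead, Finset.sum_sigma']
  symm
  refine Finset.sum_bij_ne_zero (fun s _ _ ↦ ⟨s.2, s.1 - 1⟩) ?_ ?_ ?_ ?_
  · rintro ⟨i, j⟩ hs h0
    have hc : (F j).coeff i ≠ 0 := fun hc ↦ h0 (by simp [hc])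
    have := hF i j hc
    simp only [Finset.mem_sigma, Finset.mem_range]
    have : i ≠ 0 := fun hc ↦ h0 (by simp [hc])
    omega
  · rintro ⟨i, j⟩ _ h0 ⟨i', j'⟩ _ h0' heq
    have : i ≠ 0 := fun hc ↦ h0 (by simp [hc])
    have : i' ≠ 0 := fun hc ↦ h0' (by simp [hc])
    simp only [Sigma.mk.injEq, heq_eq_eq] at heq
    ext <;> simp <;> omega
  · rintro ⟨j, i⟩ _ h0
    have hw : p * i + q * j = d - p := by
      by_contra hw
      exact h0 (if_neg hw)
    have hc : (F j).coeff (i + 1) ≠ 0 := fun hc ↦ h0 (by simp [coeff_dx, hc])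
    have hmem : (i + 1, j) ∈ S := by
      rcases hd _ _ hc with h | h | h
      · omega
      · push_cast at h
        linarith
      · exact h
    refine ⟨(i + 1, j), hmem, ?_, by simp⟩
    simp only [hw, if_true, coeff_dx] at h0
    refine fun h ↦ h0 ?_
    push_cast at h
    linarith
  · rintro ⟨i, j⟩ hs h0
    have : i ≠ 0 := fun hc ↦ h0 (by simp [hc])
    obtain ⟨k, rfl⟩ := Nat.exists_eq_succ_of_ne_zero this
    have := hS _ hs
    rw [if_pos (by push_cast at this ⊢; linarith), coeff_dx]
    push_cast
    ring

lemma lead_dy_eq (hF : Supp F fun i j ↦ i + j ≤ 6) {p q d : ℤ} {S : Finset (ℕ × ℕ)}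
    (hS : ∀ s ∈ S, p * s.1 + q * s.2 = d)
    (hd : Supp F fun i j ↦ i = 0 ∧ j = 0 ∨ p * i + q * j < d ∨ (i, j) ∈ S) (x y : ℝ) :
    lead (dy F) p q (d - q) x y =
      ∑ s ∈ S, s.2 * (F s.2).coeff s.1 * (x ^ s.1 * y ^ (s.2 - 1)) := by
  rw [lead, Finset.sum_sigma']
  symm
  refine Finset.sum_bij_ne_zero (fun s _ _ ↦ ⟨s.2 - 1, s.1⟩) ?_ ?_ ?_ ?_
  · rintro ⟨i, j⟩ hs h0
    have hc : (F j).coeff i ≠ 0 := fun hc ↦ h0 (by simp [hc])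
    have := hF i j hc
    simp only [Finset.mem_sigma, Finset.mem_range]
    have : j ≠ 0 := fun hc ↦ h0 (by simp [hc])
    omega
  · rintro ⟨i, j⟩ _ h0 ⟨i', j'⟩ _ h0' heq
    have : j ≠ 0 := fun hc ↦ h0 (by simp [hc])
    have : j' ≠ 0 := fun hc ↦ h0' (by simp [hc])
    simp only [Sigma.mk.injEq, heq_eq_eq] at heq
    ext <;> simp <;> omega
  · rintro ⟨j, i⟩ _ h0
    have hw : p * i + q * j = d - q := by
      by_contra hw
      exact h0 (if_neg hw)
    have hc : (F (j + 1)).coeff i ≠ 0 := fun hc ↦ h0 (by simp [coeff_dy, hc])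
    have hmem : (i, j + 1) ∈ S := by
      rcases hd _ _ hc with h | h | h
      · omega
      · push_cast at h
        linarith
      · exact h
    refine ⟨(i, j + 1), hmem, ?_, by simp⟩
    simp only [hw, if_true, coeff_dy] at h0
    refine fun h ↦ h0 ?_
    push_cast at h
    linarith
  · rintro ⟨i, j⟩ hs h0
    have : j ≠ 0 := fun hc ↦ h0 (by simp [hc])
    obtain ⟨k, rfl⟩ := Nat.exists_eq_succ_of_ne_zero this
    have := hS _ hs
    rw [if_pos (by push_cast at this ⊢; linarith), coeff_dy]
    push_cast
    ring

/-- Explicit form of `jac_lead_nonneg` when the monomials of top weight of `F` and `G` lie in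
finite sets `S` and `T`. -/
theorem jac_lead_nonneg_of_finset (hJ : ∀ x y, 0 < jac F G x y)
    (hF : Supp F fun i j ↦ i + j ≤ 6) (hG : Supp G fun i j ↦ i + j ≤ 6) (p q d e : ℤ)
    {S T : Finset (ℕ × ℕ)} (hS : ∀ s ∈ S, p * s.1 + q * s.2 = d)
    (hT : ∀ s ∈ T, p * s.1 + q * s.2 = e)
    (hd : Supp F fun i j ↦ i = 0 ∧ j = 0 ∨ p * i + q * j < d ∨ (i, j) ∈ S)
    (he : Supp G fun i j ↦ i = 0 ∧ j = 0 ∨ p * i + q * j < e ∨ (i, j) ∈ T) (x y : ℝ) :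
    0 ≤ ∑ s ∈ S, ∑ t ∈ T, ((s.1 * t.2 - s.2 * t.1 : ℤ) : ℝ) *
      ((F s.2).coeff s.1 * (G t.2).coeff t.1 * (x ^ (s.1 + t.1 - 1) * y ^ (s.2 + t.2 - 1))) := by
  have h := jac_lead_nonneg hJ hF hG p q d e
    (hd.mono fun i j h ↦ by
      rcases h with h | h | h
      · exact Or.inl h
      · exact Or.inr h.le
      · exact Or.inr (hS _ h).le)
    (he.mono fun i j h ↦ by
      rcases h with h | h | h
      · exact Or.inl h
      · exact Or.inr h.le
      · exact Or.inr (hT _ h).le) x y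
  rw [lead_dx_eq hF hS hd, lead_dx_eq hG hT he, lead_dy_eq hF hS hd, lead_dy_eq hG hT he,
    Finset.sum_mul_sum, Finset.sum_mul_sum, ← Finset.sum_sub_distrib] at h
  refine h.trans_eq (Finset.sum_congr rfl fun s _ ↦ ?_)
  rw [← Finset.sum_sub_distrib]
  refine Finset.sum_congr rfl fun t _ ↦ ?_
  obtain ⟨i, j⟩ := s
  obtain ⟨k, l⟩ := t
  push_cast
  have e1 : (i : ℝ) * l * (x ^ (i - 1) * x ^ k * (y ^ j * y ^ (l - 1)))
      = i * l * (x ^ (i + k - 1) * y ^ (j + l - 1)) := by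
    rcases i with _ | i
    · simp
    rcases l with _ | l
    · simp
    rw [← pow_add, ← pow_add, show i + 1 - 1 + k = i + 1 + k - 1 by omega,
      show j + (l + 1 - 1) = j + (l + 1) - 1 by omega]
  have e2 : (j : ℝ) * k * (x ^ i * x ^ (k - 1) * (y ^ (j - 1) * y ^ l))
      = j * k * (x ^ (i + k - 1) * y ^ (j + l - 1)) := by
    rcases j with _ | j
    · simp
    rcases k with _ | k
    · simp
    rw [← pow_add, ← pow_add, show j + 1 - 1 + l = j + 1 + l - 1 by omega,
      show i + (k + 1 - 1) = i + (k + 1) - 1 by omega]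
  linear_combination ((F j).coeff i * (G l).coeff k) * e1 - ((F j).coeff i * (G l).coeff k) * e2

lemma cubic_nonneg {A B C D : ℝ} (h : ∀ z, 0 ≤ A + B * z + C * z ^ 2 + D * z ^ 3) : D = 0 := by
  by_contra hD
  have hD' : 0 < |D| := abs_pos.mpr hD
  set M := |A| + |B| + |C| with hM
  have hM0 : 0 ≤ M := by positivity
  obtain ⟨t, ht1, ht⟩ : ∃ t, 1 ≤ t ∧ M < |D| * t := by
    refine ⟨M / |D| + 1, by have := div_nonneg hM0 hD'.le; linarith, ?_⟩
    rw [mul_add, mul_div_cancel₀ _ hD'.ne']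
    linarith
  have h1 := h t
  have h2 := h (-t)
  have key : |D| * t ^ 3 ≤ M * t ^ 2 := by
    have e : |D| * t ^ 3 = |D * t ^ 3| := by rw [abs_mul, abs_of_pos (by positivity : 0 < t ^ 3)]
    have e1 : |D * t ^ 3 + B * t| ≤ A + C * t ^ 2 := abs_le.mpr ⟨by linarith, by linarith⟩
    have e2 : |D * t ^ 3| ≤ |D * t ^ 3 + B * t| + |B * t| := by
      have := abs_sub (D * t ^ 3 + B * t) (B * t)
      rwa [add_sub_cancel_right] at this
    rw [abs_mul B, abs_of_pos (by linarith : 0 < t)] at e2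
    have e3 := le_abs_self A
    have e4 := mul_le_mul_of_nonneg_right (le_abs_self C) (sq_nonneg t)
    have e5 : |B| * t ≤ |B| * t ^ 2 := mul_le_mul_of_nonneg_left (by nlinarith) (abs_nonneg B)
    have e6 : |A| ≤ |A| * t ^ 2 := le_mul_of_one_le_right (abs_nonneg A) (by nlinarith)
    rw [e]
    nlinarith
  nlinarith [pow_pos (by linarith : 0 < t) 2]

lemma quartic_nonneg {A B : ℝ} (h : ∀ s, 0 ≤ A * s ^ 2 + B * s ^ 4)
    (h' : ∀ s, 0 ≤ A * s ^ 2 - B * s ^ 4) : B = 0 := by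
  by_contra hB
  have hB' : 0 < |B| := abs_pos.mpr hB
  obtain ⟨s, hs⟩ : ∃ s : ℝ, s ^ 2 = (|A| + 1) / |B| :=
    ⟨√((|A| + 1) / |B|), Real.sq_sqrt (by positivity)⟩
  have hpos : 0 < s ^ 2 := by rw [hs]; positivity
  have e : |B| * s ^ 2 = |A| + 1 := by rw [hs]; field_simp
  have key : |B| * s ^ 4 ≤ A * s ^ 2 := by
    rw [← abs_of_nonneg (by positivity : 0 ≤ s ^ 4), ← abs_mul]
    exact abs_le.mpr ⟨by linarith [h s], by linarith [h' s]⟩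
  have := le_abs_self A
  nlinarith

/-- If `f` is affine in `y` with nonvanishing slope then the pair is injective. -/
lemma injective_of_affine_of_ne_zero (ho : IsOpenMap (toMap F G))
    (hF : Supp F fun i j ↦ j ≤ 1) (h : ∀ x, (F 1).eval x ≠ 0) :
    Function.Injective (toMap F G) := by
  have hbi : ∀ x y, bi F x y = (F 0).eval x + (F 1).eval x * y := fun x y ↦ by
    simp [bi, Finset.sum_range_succ, hF.eq_zero (j := 2) (by omega),
      hF.eq_zero (j := 3) (by omega), hF.eq_zero (j := 4) (by omega),
      hF.eq_zero (j := 5) (by omega), hF.eq_zero (j := 6) (by omega)]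
  have hc : (∀ x, 0 < (F 1).eval x) ∨ ∀ x, (F 1).eval x < 0 := by
    by_contra! hcon
    obtain ⟨⟨a, ha⟩, b, hb⟩ := hcon
    obtain ⟨c, hc⟩ := mem_range_of_exists_le_of_exists_ge (F 1).continuous ⟨a, ha⟩ ⟨b, hb⟩
    exact h c hc
  have hsw : ∀ x y, Homeomorph.prodComm ℝ ℝ (x, y) = (y, x) := fun _ _ ↦ rfl
  refine injective_of_homeomorph ho (Homeomorph.prodComm ℝ ℝ) ?_ ?_
  · simp only [hsw, hbi]
    rcases hc with hc | hc
    · exact Or.inl fun y x x' hx ↦ by nlinarith [hc y, mul_lt_mul_of_pos_left hx (hc y)]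
    · exact Or.inr fun y x x' hx ↦ by nlinarith [hc y, mul_lt_mul_of_neg_left hx (hc y)]
  · intro y c
    refine ⟨(c - (F 0).eval y) / (F 1).eval y, ?_⟩
    simp only [hsw, hbi]
    have := h y
    field_simp
    ring

/-- If `f` depends only on `x` then the pair is injective. -/
lemma injective_of_univariate (hJ : ∀ x y, 0 < jac F G x y) (ho : IsOpenMap (toMap F G))
    (hF : Supp F fun i j ↦ j = 0) : Function.Injective (toMap F G) := by
  have hz : ∀ j, j ≠ 0 → F j = 0 := fun j hj ↦ hF.eq_zero (by simpa using hj)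
  have hbi : ∀ x y, bi F x y = (F 0).eval x := fun x y ↦ by
    simp [bi, Finset.sum_range_succ, hz]
  have hd : ∀ x, (F 0).derivative.eval x ≠ 0 := fun x h0 ↦ by
    have := hJ x 0
    simp [jac, bi, dx, dy, hz, Finset.sum_range_succ, h0] at this
  refine injective_of_homeomorph ho (Homeomorph.refl _) ?_ ?_
  · simp only [Homeomorph.refl_apply, id, hbi]
    rcases strictMono_or_strictAnti_of_derivative hd with h | h
    · exact Or.inl fun _ ↦ h
    · exact Or.inr fun _ ↦ h
  · simp only [Homeomorph.refl_apply, id, hbi]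
    exact fun _ ↦ surjective_of_derivative hd

lemma affine_case_quadratic (hJ : ∀ x y, 0 < jac F G x y)
    (hF : Supp F fun i j ↦ i ≤ 6 ∧ j = 0 ∨ j = 1 ∧ (i = 2 ∨ i = 3))
    (hG : Supp G fun i j ↦ i + j ≤ 6 ∧ (j = 0 ∨ j = 1 ∧ i ≤ 4 ∨ j = 2 ∧ i ≤ 3 ∨ j = 3 ∧ i ≤ 2 ∨
      j = 4 ∧ i = 0)) (ha : (F 0).coeff 1 ≠ 0) (hk : (F 1).coeff 2 ≠ 0) :
    (G 1).coeff 0 = 0 := by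
  have hG4 : (G 4).coeff 0 = 0 := by
    have h := jac_lead_nonneg_of_finset hJ (hF.mono (by omega)) (hG.mono (by omega)) (-1) 1 (-1) 4
      (S := {(1, 0), (2, 1)}) (T := {(0, 4)}) (by simp) (by simp)
      (hF.mono (by simp; omega)) (hG.mono (by simp; omega))
    simp at h
    have h1 := h 0 1
    have h2 := h 0 (-1)
    norm_num at h1 h2
    have : (F 0).coeff 1 * (G 4).coeff 0 = 0 := by linarith
    simpa [ha] using this
  replace hG := hG.erase hG4
  have hG3 : (G 3).coeff 0 = 0 := by
    have h := jac_lead_nonneg_of_finset hJ (hF.mono (by omega)) (hG.mono (by omega)) (-1) 1 (-1) 3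
      (S := {(1, 0), (2, 1)}) (T := {(0, 3)}) (by simp) (by simp)
      (hF.mono (by simp; omega)) (hG.mono (by simp; omega))
    simp at h
    have := quadratic_nonneg (A := 3 * ((F 0).coeff 1 * (G 3).coeff 0))
      (B := 6 * ((F 1).coeff 2 * (G 3).coeff 0)) (C := 0) fun z ↦ by
        have := h z 1
        norm_num at this
        linarith
    have : (F 1).coeff 2 * (G 3).coeff 0 = 0 := by nlinarith
    simpa [hk] using this
  replace hG := hG.erase hG3
  have h2 : (G 2).coeff 0 = 0 ∧ (G 3).coeff 1 = 0 := by
    have h := jac_lead_nonneg_of_finset hJ (hF.mono (by omega)) (hG.mono (by omega)) (-1) 1 (-1) 2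
      (S := {(1, 0), (2, 1)}) (T := {(0, 2), (1, 3)}) (by simp) (by simp)
      (hF.mono (by simp; omega)) (hG.mono (by simp; omega))
    simp at h
    have h1 := h 0 1
    have h2 := h 0 (-1)
    have h3 := h 1 1
    have h4 := h (-1) (-1)
    have h5 := h 1 (-1)
    have h6 := h (-1) 1
    norm_num at h1 h2 h3 h4 h5 h6
    have e1 : (F 0).coeff 1 * (G 2).coeff 0 = 0 := by linarith
    have e2 : (G 2).coeff 0 = 0 := by simpa [ha] using e1
    rw [e2] at h3 h4 h5 h6
    have e3 : (F 1).coeff 2 * (G 3).coeff 1 = 0 := by linarith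
    exact ⟨e2, by simpa [hk] using e3⟩
  replace hG := (hG.erase h2.1).erase h2.2
  have h := jac_lead_nonneg_of_finset hJ (hF.mono (by omega)) (hG.mono (by omega)) (-1) 1 (-1) 1
    (S := {(1, 0), (2, 1)}) (T := {(0, 1), (1, 2), (2, 3)}) (by simp) (by simp)
    (hF.mono (by simp; omega)) (hG.mono (by simp; omega))
  simp at h
  have hc : (F 1).coeff 2 * (G 3).coeff 2 = 0 := by
    have := cubic_nonneg (A := (F 0).coeff 1 * (G 1).coeff 0)
      (B := 2 * ((F 1).coeff 2 * (G 1).coeff 0) + 2 * ((F 0).coeff 1 * (G 2).coeff 1))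
      (C := 3 * ((F 0).coeff 1 * (G 3).coeff 2) + 3 * ((F 1).coeff 2 * (G 2).coeff 1))
      (D := 4 * ((F 1).coeff 2 * (G 3).coeff 2)) fun z ↦ by
        have := h z 1
        norm_num at this
        linarith
    linarith
  have hc : (G 3).coeff 2 = 0 := by simpa [hk] using hc
  have := quadratic_nonneg (A := (F 0).coeff 1 * (G 1).coeff 0)
    (B := 2 * ((F 1).coeff 2 * (G 1).coeff 0) + 2 * ((F 0).coeff 1 * (G 2).coeff 1))
    (C := 3 * ((F 1).coeff 2 * (G 2).coeff 1)) fun z ↦ by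
      have := h z 1
      norm_num [hc] at this
      linarith
  have hP : (F 1).coeff 2 * (G 1).coeff 0 = 0 := by
    nlinarith [sq_nonneg (2 * ((F 0).coeff 1 * (G 2).coeff 1) - (F 1).coeff 2 * (G 1).coeff 0),
      sq_nonneg ((F 1).coeff 2 * (G 1).coeff 0)]
  simpa [hk] using hP

lemma affine_case_cubic (hJ : ∀ x y, 0 < jac F G x y)
    (hF : Supp F fun i j ↦ i ≤ 6 ∧ j = 0 ∨ j = 1 ∧ i = 3)
    (hG : Supp G fun i j ↦ i + j ≤ 6 ∧ (j = 0 ∨ j = 1 ∧ i ≤ 4 ∨ j = 2 ∧ i ≤ 3 ∨ j = 3 ∧ i ≤ 2 ∨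
      j = 4 ∧ i = 0)) (ha : (F 0).coeff 1 ≠ 0) (hk : (F 1).coeff 3 ≠ 0) :
    (G 1).coeff 0 = 0 := by
  have hG4 : (G 4).coeff 0 = 0 := by
    have h := jac_lead_nonneg_of_finset hJ (hF.mono (by omega)) (hG.mono (by omega)) (-1) 2 (-1) 8
      (S := {(1, 0), (3, 1)}) (T := {(0, 4)}) (by simp) (by simp)
      (hF.mono (by simp; omega)) (hG.mono (by simp; omega))
    simp at h
    have h1 := h 0 1
    have h2 := h 0 (-1)
    norm_num at h1 h2
    have : (F 0).coeff 1 * (G 4).coeff 0 = 0 := by linarith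
    simpa [ha] using this
  replace hG := hG.erase hG4
  have hG3 : (G 3).coeff 0 = 0 := by
    have h := jac_lead_nonneg_of_finset hJ (hF.mono (by omega)) (hG.mono (by omega)) (-1) 2 (-1) 6
      (S := {(1, 0), (3, 1)}) (T := {(0, 3)}) (by simp) (by simp)
      (hF.mono (by simp; omega)) (hG.mono (by simp; omega))
    simp at h
    have := quadratic_nonneg (A := 3 * ((F 0).coeff 1 * (G 3).coeff 0))
      (B := 0) (C := 9 * ((F 1).coeff 3 * (G 3).coeff 0)) fun z ↦ by
        have := h z 1
        norm_num at this
        linarith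
    have := quadratic_nonneg (A := 3 * ((F 0).coeff 1 * (G 3).coeff 0))
      (B := 0) (C := -(9 * ((F 1).coeff 3 * (G 3).coeff 0))) fun z ↦ by
        have := h z (-1)
        norm_num at this
        linarith
    have : (F 0).coeff 1 * (F 1).coeff 3 * ((G 3).coeff 0) ^ 2 = 0 := by linarith
    simpa [ha, hk] using this
  replace hG := hG.erase hG3
  have hG31 : (G 3).coeff 1 = 0 := by
    have h := jac_lead_nonneg_of_finset hJ (hF.mono (by omega)) (hG.mono (by omega)) (-1) 2 (-1) 5
      (S := {(1, 0), (3, 1)}) (T := {(1, 3)}) (by simp) (by simp)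
      (hF.mono (by simp; omega)) (hG.mono (by simp; omega))
    simp at h
    have h3 := h 1 1
    have h4 := h (-1) (-1)
    have h5 := h 1 (-1)
    have h6 := h (-1) 1
    norm_num at h3 h4 h5 h6
    have : (F 0).coeff 1 * (G 3).coeff 1 = 0 := by linarith
    simpa [ha] using this
  replace hG := hG.erase hG31
  have h2 : (G 2).coeff 0 = 0 ∧ (G 3).coeff 2 = 0 := by
    have h := jac_lead_nonneg_of_finset hJ (hF.mono (by omega)) (hG.mono (by omega)) (-1) 2 (-1) 4
      (S := {(1, 0), (3, 1)}) (T := {(0, 2), (2, 3)}) (by simp) (by simp)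
      (hF.mono (by simp; omega)) (hG.mono (by simp; omega))
    simp at h
    have h1 := h 0 1
    have h2 := h 0 (-1)
    norm_num at h1 h2
    have e1 : (F 0).coeff 1 * (G 2).coeff 0 = 0 := by linarith
    have e2 : (G 2).coeff 0 = 0 := by simpa [ha] using e1
    have := quartic_nonneg (A := 3 * ((F 0).coeff 1 * (G 3).coeff 2))
      (B := 7 * ((F 1).coeff 3 * (G 3).coeff 2)) (fun s ↦ by
        have := h s 1
        norm_num [e2] at this
        linarith) (fun s ↦ by
        have := h s (-1)
        norm_num [e2] at this
        linarith)
    exact ⟨e2, by simpa [hk] using this⟩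
  replace hG := (hG.erase h2.1).erase h2.2
  have hG21 : (G 2).coeff 1 = 0 := by
    have h := jac_lead_nonneg_of_finset hJ (hF.mono (by omega)) (hG.mono (by omega)) (-1) 2 (-1) 3
      (S := {(1, 0), (3, 1)}) (T := {(1, 2)}) (by simp) (by simp)
      (hF.mono (by simp; omega)) (hG.mono (by simp; omega))
    simp at h
    have h3 := h 1 1
    have h4 := h (-1) (-1)
    have h5 := h 1 (-1)
    have h6 := h (-1) 1
    norm_num at h3 h4 h5 h6
    have : (F 0).coeff 1 * (G 2).coeff 1 = 0 := by linarith
    simpa [ha] using this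
  replace hG := hG.erase hG21
  have h := jac_lead_nonneg_of_finset hJ (hF.mono (by omega)) (hG.mono (by omega)) (-1) 2 (-1) 2
    (S := {(1, 0), (3, 1)}) (T := {(0, 1), (2, 2)}) (by simp) (by simp)
    (hF.mono (by simp; omega)) (hG.mono (by simp; omega))
  simp at h
  have := quadratic_nonneg (A := (F 0).coeff 1 * (G 1).coeff 0)
    (B := 3 * ((F 1).coeff 3 * (G 1).coeff 0) + 2 * ((F 0).coeff 1 * (G 2).coeff 2))
    (C := 4 * ((F 1).coeff 3 * (G 2).coeff 2)) fun z ↦ by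
      have := h 1 z
      norm_num at this
      linarith
  have hP : (F 1).coeff 3 * (G 1).coeff 0 = 0 := by
    nlinarith [sq_nonneg (2 * ((F 0).coeff 1 * (G 2).coeff 2) - (F 1).coeff 3 * (G 1).coeff 0),
      sq_nonneg ((F 1).coeff 3 * (G 1).coeff 0)]
  simpa [hk] using hP

/-- Injectivity when `f` is affine in `y`. -/
theorem injective_of_affine (hJ : ∀ x y, 0 < jac F G x y)
    (hF : Supp F fun i j ↦ i ≤ 6 ∧ j = 0 ∨ i ≤ 3 ∧ j = 1)
    (hG : Supp G fun i j ↦ i + j ≤ 6 ∧ (j = 0 ∨ j = 1 ∧ i ≤ 4 ∨ j = 2 ∧ i ≤ 3 ∨ j = 3 ∧ i ≤ 2 ∨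
      j = 4 ∧ i = 0)) : Function.Injective (toMap F G) := by
  by_cases hroot : ∀ x, (F 1).eval x ≠ 0
  · exact injective_of_affine_of_ne_zero
      (isOpenMap_toMap (hF.mono (by omega)) (hG.mono (by omega)) hJ) (hF.mono (by omega)) hroot
  push Not at hroot
  obtain ⟨s, hs⟩ := hroot
  refine injective_of_shift s ?_
  have hJ' : ∀ x y, 0 < jac (shift s F) (shift s G) x y := fun x y ↦ by
    rw [jac_shift]; exact hJ _ _
  have h0 : (shift s F 1).coeff 0 = 0 := by
    rw [shift, Polynomial.taylor_coeff_zero, hs]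
  replace hF := hF.shift s (by omega)
  replace hG := hG.shift s (by omega)
  clear hJ hs
  generalize shift s F = F at *
  generalize shift s G = G at *
  have hF2 : ∀ j, 2 ≤ j → F j = 0 := fun j hj ↦ hF.eq_zero (by omega)
  have key : ∀ y, 0 < ((F 0).coeff 1 + (F 1).coeff 1 * y) * bi (dy G) 0 y := fun y ↦ by
    have := hJ' 0 y
    have e1 : bi (dy F) 0 y = 0 := by
      simp [bi, dy, hF2, Finset.sum_range_succ, ← Polynomial.coeff_zero_eq_eval_zero, h0]
    have e2 : bi (dx F) 0 y = (F 0).coeff 1 + (F 1).coeff 1 * y := by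
      simp [bi, dx, hF2, Finset.sum_range_succ, ← Polynomial.coeff_zero_eq_eval_zero,
        Polynomial.coeff_derivative]
    rwa [jac, e1, e2, zero_mul, sub_zero] at this
  have h1 : (F 1).coeff 1 = 0 := by
    by_contra hne
    have := key (-(F 0).coeff 1 / (F 1).coeff 1)
    rw [mul_div_cancel₀ _ hne, add_neg_cancel, zero_mul] at this
    exact this.false
  have key0 := key 0
  have hq : bi (dy G) 0 0 = (G 1).coeff 0 := by
    simp [bi, dy, Finset.sum_range_succ, ← Polynomial.coeff_zero_eq_eval_zero]
  rw [mul_zero, add_zero, hq] at key0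
  have ha : (F 0).coeff 1 ≠ 0 := left_ne_zero_of_mul key0.ne'
  have hq : (G 1).coeff 0 ≠ 0 := right_ne_zero_of_mul key0.ne'
  replace hF := (hF.erase h0).erase h1
  by_cases h2 : (F 1).coeff 2 = 0
  · by_cases h3 : (F 1).coeff 3 = 0
    · exact injective_of_univariate hJ'
        (isOpenMap_toMap (hF.mono (by omega)) (hG.mono (by omega)) hJ')
        (((hF.erase h2).erase h3).mono (by omega))
    · exact absurd (affine_case_cubic hJ' ((hF.erase h2).mono (by omega)) hG ha h3) hq
  · exact absurd (affine_case_quadratic hJ' (hF.mono (by omega)) hG ha h2) hq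

lemma exists_discriminant_zero {α : ℝ[X]} (hα : 0 < α.degree) {β c : ℝ} (hβ : 0 < β)
    (hE : ∀ x, 0 < β ^ 2 + 4 * x ^ 2 * α.derivative.eval x) :
    ∃ x₁, 0 < x₁ ∧ β ^ 2 + 4 * x₁ * (c - α.eval x₁) = 0 ∧
      (∀ x, 0 < x → x < x₁ → 0 < β ^ 2 + 4 * x * (c - α.eval x)) ∧
      ∀ x, x₁ < x → β ^ 2 + 4 * x * (c - α.eval x) < 0 := by
  set m : ℝ → ℝ := fun x ↦ α.eval x - β ^ 2 / (4 * x) with hm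
  have hmono : StrictMonoOn m (Set.Ioi 0) := by
    have hd : ∀ x ∈ Set.Ioi (0 : ℝ), HasDerivAt m
        ((β ^ 2 + 4 * x ^ 2 * α.derivative.eval x) / (4 * x ^ 2)) x := by
      intro x hx
      have hx' : x ≠ 0 := (Set.mem_Ioi.mp hx).ne'
      have h1 := (hasDerivAt_inv hx').const_mul (β ^ 2 / 4)
      have h2 := (α.hasDerivAt x).sub h1
      refine (h2.congr_of_eventuallyEq ?_).congr_deriv ?_
      · filter_upwards with z
        simp only [hm, Pi.sub_apply]
        congr 1
        rw [div_eq_mul_inv, mul_inv]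
        ring
      · field_simp
        ring
    refine strictMonoOn_of_deriv_pos (convex_Ioi 0)
      (fun x hx ↦ (hd x hx).continuousAt.continuousWithinAt) fun x hx ↦ ?_
    rw [interior_Ioi] at hx
    rw [(hd x hx).deriv]
    have hx' : 0 < x := hx
    exact div_pos (hE x) (by positivity)
  have hD : ∀ x, 0 < x → β ^ 2 + 4 * x * (c - α.eval x) = 4 * x * (c - m x) := by
    intro x hx
    simp only [hm]
    field_simp
    ring
  have hbig : ∃ x, 0 < x ∧ c < m x := by
    have h1 := tendsto_atTop.mp (α.abs_tendsto_atTop hα) (|c| + |m 1| + β ^ 2 + 1)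
    obtain ⟨x, hx, hx1⟩ := (h1.and (eventually_gt_atTop 1)).exists
    refine ⟨x, by linarith, ?_⟩
    have h2 := hmono (Set.mem_Ioi.mpr one_pos) (Set.mem_Ioi.mpr (by linarith)) hx1
    have h3 : β ^ 2 / (4 * x) ≤ β ^ 2 := div_le_self (sq_nonneg β) (by linarith)
    have h4 : 0 < β ^ 2 / (4 * x) := by positivity
    have h5 := neg_abs_le (m 1)
    have h6 := le_abs_self c
    have h7 : m x = α.eval x - β ^ 2 / (4 * x) := rfl
    have h8 := abs_nonneg c
    rcases abs_cases (α.eval x) with h | h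
    · linarith [abs_nonneg (m 1)]
    · nlinarith
  obtain ⟨x₃, hx₃, hc⟩ := hbig
  have hcont : ContinuousOn (fun x ↦ β ^ 2 + 4 * x * (c - α.eval x)) (Set.Icc 0 x₃) := by
    fun_prop
  have h0 : (0 : ℝ) ∈ Set.Ioo (β ^ 2 + 4 * x₃ * (c - α.eval x₃)) (β ^ 2 + 4 * 0 * (c - α.eval 0)) := by
    constructor
    · rw [hD _ hx₃]
      nlinarith
    · nlinarith
  obtain ⟨x₁, hx₁, hz⟩ := intermediate_value_Ioo' hx₃.le hcont h0
  simp only at hz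
  have hpos : 0 < x₁ := hx₁.1
  have hcm : c = m x₁ := by
    rw [hD _ hpos] at hz
    have : c - m x₁ = 0 := by simpa [hpos.ne'] using hz
    linarith
  refine ⟨x₁, hpos, hz, fun x hx hlt ↦ ?_, fun x hlt ↦ ?_⟩
  · have := hmono (Set.mem_Ioi.mpr hx) (Set.mem_Ioi.mpr hpos) hlt
    rw [hD x hx]
    exact mul_pos (by linarith) (by linarith)
  · have := hmono (Set.mem_Ioi.mpr hpos) (Set.mem_Ioi.mpr (hpos.trans hlt)) hlt
    rw [hD x (hpos.trans hlt)]
    exact mul_neg_of_pos_of_neg (by linarith) (by linarith)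

lemma exists_discriminant_zero_neg {α : ℝ[X]} (hα : 0 < α.degree) {β c : ℝ} (hβ : 0 < β)
    (hE : ∀ x, 0 < β ^ 2 + 4 * x ^ 2 * α.derivative.eval x) :
    ∃ x₂, x₂ < 0 ∧ β ^ 2 + 4 * x₂ * (c - α.eval x₂) = 0 ∧
      (∀ x, x < 0 → x₂ < x → 0 < β ^ 2 + 4 * x * (c - α.eval x)) ∧
      ∀ x, x < x₂ → β ^ 2 + 4 * x * (c - α.eval x) < 0 := by
  have hα' : 0 < (-α.comp (-Polynomial.X)).degree := by
    rw [Polynomial.degree_neg]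
    rw [← Polynomial.natDegree_pos_iff_degree_pos] at hα ⊢
    simpa [Polynomial.natDegree_comp] using hα
  obtain ⟨x₁, h1, h2, h3, h4⟩ := exists_discriminant_zero hα' (c := -c) hβ fun x ↦ by
    have := hE (-x)
    simpa [Polynomial.derivative_comp] using this
  simp only [Polynomial.eval_neg, Polynomial.eval_comp, Polynomial.eval_X] at h2 h3 h4
  refine ⟨-x₁, by linarith, by linarith, fun x hx hlt ↦ ?_, fun x hlt ↦ ?_⟩
  · have := h3 (-x) (by linarith) (by linarith)
    rw [neg_neg] at this
    linarith
  · have := h4 (-x) (by linarith)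
    rw [neg_neg] at this
    linarith

lemma hasDerivAt_along_level {f g : ℝ → ℝ → ℝ} {fx fy gx gy x c : ℝ} {y : ℝ → ℝ}
    (hf : HasFDerivAt (fun P : ℝ × ℝ ↦ f P.1 P.2)
      (fx • ContinuousLinearMap.fst ℝ ℝ ℝ + fy • ContinuousLinearMap.snd ℝ ℝ ℝ) (x, y x))
    (hg : HasFDerivAt (fun P : ℝ × ℝ ↦ g P.1 P.2)
      (gx • ContinuousLinearMap.fst ℝ ℝ ℝ + gy • ContinuousLinearMap.snd ℝ ℝ ℝ) (x, y x))
    (hy : DifferentiableAt ℝ y x) (hc : ∀ᶠ z in 𝓝 x, f z (y z) = c) (hfy : fy ≠ 0) :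
    HasDerivAt (fun z ↦ g z (y z)) (-(fx * gy - fy * gx) / fy) x := by
  have hpath : HasDerivAt (fun z ↦ (z, y z)) (1, deriv y x) x :=
    (hasDerivAt_id x).prodMk hy.hasDerivAt
  have h1 := hf.comp_hasDerivAt x hpath
  have h2 := hg.comp_hasDerivAt x hpath
  have h3 : HasDerivAt ((fun P : ℝ × ℝ ↦ f P.1 P.2) ∘ fun z ↦ (z, y z)) 0 x :=
    (hasDerivAt_const x c).congr_of_eventuallyEq hc
  have h4 := h1.unique h3
  simp at h4
  refine h2.congr_deriv ?_
  simp
  field_simp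
  linear_combination gy * h4

theorem injective_of_loop_of_pos {α : ℝ[X]} (hα : 0 < α.degree) {β : ℝ} (hβ : 0 < β)
    {g gx gy : ℝ → ℝ → ℝ}
    (hg : ∀ x y, HasFDerivAt (fun P : ℝ × ℝ ↦ g P.1 P.2)
      (gx x y • ContinuousLinearMap.fst ℝ ℝ ℝ + gy x y • ContinuousLinearMap.snd ℝ ℝ ℝ) (x, y))
    (hJ : ∀ x y, 0 < (y ^ 2 + α.derivative.eval x) * gy x y - (2 * x * y + β) * gx x y) :
    Function.Injective fun P : ℝ × ℝ ↦ (P.1 * P.2 ^ 2 + β * P.2 + α.eval P.1, g P.1 P.2) := by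
  have hE : ∀ x, 0 < β ^ 2 + 4 * x ^ 2 * α.derivative.eval x := by
    have hne : ∀ x, β ^ 2 + 4 * x ^ 2 * α.derivative.eval x ≠ 0 := by
      intro x h0
      rcases eq_or_ne x 0 with rfl | hx
      · simp at h0
        exact hβ.ne' h0
      · have := hJ x (-β / (2 * x))
        have e1 : (-β / (2 * x)) ^ 2 + α.derivative.eval x = 0 := by
          field_simp
          linarith
        have e2 : 2 * x * (-β / (2 * x)) + β = 0 := by
          field_simp
          ring
        rw [e1, e2] at this
        simp at this
    intro x
    by_contra! hle
    have hcont : Continuous fun x ↦ β ^ 2 + 4 * x ^ 2 * α.derivative.eval x := by fun_prop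
    obtain ⟨z, hz⟩ := mem_range_of_exists_le_of_exists_ge hcont ⟨x, hle⟩
      ⟨0, by simp; positivity⟩
    exact hne z hz
  have hf : ∀ x y, HasFDerivAt (fun P : ℝ × ℝ ↦ P.1 * P.2 ^ 2 + β * P.2 + α.eval P.1)
      ((y ^ 2 + α.derivative.eval x) • ContinuousLinearMap.fst ℝ ℝ ℝ
        + (2 * x * y + β) • ContinuousLinearMap.snd ℝ ℝ ℝ) (x, y) := by
    intro x y
    have h1 : HasFDerivAt (fun P : ℝ × ℝ ↦ P.1) (ContinuousLinearMap.fst ℝ ℝ ℝ) (x, y) :=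
      hasFDerivAt_fst
    have h2 : HasFDerivAt (fun P : ℝ × ℝ ↦ P.2) (ContinuousLinearMap.snd ℝ ℝ ℝ) (x, y) :=
      hasFDerivAt_snd
    have h3 := (α.hasDerivAt x).comp_hasFDerivAt (x, y) h1
    refine (((h1.mul (h2.pow 2)).add (h2.const_mul β)).add h3).congr_fderiv ?_
    ext <;> simp
    · ring
  have hgc : Continuous fun P : ℝ × ℝ ↦ g P.1 P.2 :=
    continuous_iff_continuousAt.mpr fun P ↦ (hg P.1 P.2).continuousAt
  rintro ⟨xP, yP⟩ ⟨xQ, yQ⟩ hPQ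
  simp only [Prod.mk.injEq] at hPQ
  obtain ⟨hfe, hge⟩ := hPQ
  obtain ⟨c, hP⟩ : ∃ c, xP * yP ^ 2 + β * yP + α.eval xP = c := ⟨_, rfl⟩
  have hQ := hfe.symm.trans hP
  obtain ⟨x₁, hx₁, hD₁, hpos₁, hneg₁⟩ := exists_discriminant_zero hα (c := c) hβ hE
  obtain ⟨x₂, hx₂, hD₂, hpos₂, hneg₂⟩ := exists_discriminant_zero_neg hα (c := c) hβ hE
  set D : ℝ → ℝ := fun x ↦ β ^ 2 + 4 * x * (c - α.eval x) with hD
  have hDc : Continuous D := by fun_prop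
  have hDd : Differentiable ℝ D := by
    intro x
    simp only [hD]
    fun_prop
  have hDpos : ∀ x ∈ Set.Ioo x₂ x₁, 0 < D x := by
    intro x hx
    rcases lt_trichotomy x 0 with h | rfl | h
    · exact hpos₂ x h hx.1
    · simp only [hD]
      nlinarith
    · exact hpos₁ x h hx.2
  have hsq : ∀ x ∈ Set.Icc x₂ x₁, √(D x) ^ 2 = D x := by
    intro x hx
    refine Real.sq_sqrt ?_
    rcases hx.1.eq_or_lt with h | h
    · rw [← h]
      exact hD₂.ge
    rcases hx.2.eq_or_lt with h' | h'
    · rw [h']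
      exact hD₁.ge
    · exact (hDpos x ⟨h, h'⟩).le
  set u : ℝ → ℝ := fun x ↦ 2 * (c - α.eval x) / (β + √(D x)) with hu
  set v : ℝ → ℝ := fun x ↦ -(β + √(D x)) / (2 * x) with hv
  have hden : ∀ x, 0 < β + √(D x) := fun x ↦ by positivity
  have hu_eq : ∀ x ∈ Set.Icc x₂ x₁, 2 * x * u x + β = √(D x) := by
    intro x hx
    have h1 := hsq x hx
    have h2 := (hden x).ne'
    simp only [hu]
    field_simp
    simp only [hD] at h1 ⊢
    linarith
  have hv_eq : ∀ x, x ≠ 0 → 2 * x * v x + β = -√(D x) := by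
    intro x hx
    simp only [hv]
    field_simp
    ring
  have hfu : ∀ x ∈ Set.Icc x₂ x₁, x * u x ^ 2 + β * u x + α.eval x = c := by
    intro x hx
    have h1 := hu_eq x hx
    have h2 : (β + √(D x)) * u x = 2 * (c - α.eval x) := by
      simp only [hu]
      field_simp [(hden x).ne']
    rw [← h1] at h2
    linarith
  have hfv : ∀ x ∈ Set.Icc x₂ x₁, x ≠ 0 → x * v x ^ 2 + β * v x + α.eval x = c := by
    intro x hx h0
    have h1 := hv_eq x h0
    have h2 : (2 * x * v x + β) ^ 2 = D x := by rw [h1, neg_sq, hsq x hx]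
    have h3 : 4 * x * (x * v x ^ 2 + β * v x + α.eval x - c) = 0 := by
      simp only [hD] at h2
      linarith
    have h4 : x * v x ^ 2 + β * v x + α.eval x - c = 0 := by simpa [h0] using h3
    linarith
  have hsd : ∀ x ∈ Set.Ioo x₂ x₁, DifferentiableAt ℝ (fun x ↦ √(D x)) x := fun x hx ↦
    (hDd x).sqrt (hDpos x hx).ne'
  have hu_anti : StrictAntiOn (fun x ↦ g x (u x)) (Set.Icc x₂ x₁) := by
    have huc : Continuous u := by
      refine Continuous.div (by fun_prop) (by fun_prop) fun x ↦ (hden x).ne'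
    refine strictAntiOn_of_deriv_neg (convex_Icc _ _)
      (hgc.comp (continuous_id.prodMk huc)).continuousOn fun x hx ↦ ?_
    rw [interior_Icc] at hx
    have hs := Real.sqrt_pos.mpr (hDpos x hx)
    have he := hu_eq x (Set.Ioo_subset_Icc_self hx)
    have hud : DifferentiableAt ℝ u x :=
      DifferentiableAt.div (by fun_prop) ((hsd x hx).const_add β) (hden x).ne'
    have hder := hasDerivAt_along_level
      (f := fun x y ↦ x * y ^ 2 + β * y + α.eval x) (hf x (u x)) (hg x (u x)) hud (c := c)
      (by filter_upwards [Ioo_mem_nhds hx.1 hx.2] with z hz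
          exact hfu z (Set.Ioo_subset_Icc_self hz)) (by rw [he]; exact hs.ne')
    rw [hder.deriv]
    refine div_neg_of_neg_of_pos (neg_neg_of_pos (hJ x (u x))) (by rw [he]; exact hs)
  have hv_deriv : ∀ x ∈ Set.Ioo x₂ x₁, x ≠ 0 → 0 < deriv (fun x ↦ g x (v x)) x := by
    intro x hx h0
    have hs := Real.sqrt_pos.mpr (hDpos x hx)
    have he := hv_eq x h0
    have hvd : DifferentiableAt ℝ v x :=
      DifferentiableAt.div (((hsd x hx).const_add β).neg) (by fun_prop) (by simpa using h0)
    have hder := hasDerivAt_along_level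
      (f := fun x y ↦ x * y ^ 2 + β * y + α.eval x) (hf x (v x)) (hg x (v x)) hvd (c := c)
      (by filter_upwards [Ioo_mem_nhds hx.1 hx.2, isOpen_ne.mem_nhds h0] with z hz hz0
          exact hfv z (Set.Ioo_subset_Icc_self hz) hz0) (by rw [he]; exact (neg_neg_of_pos hs).ne)
    rw [hder.deriv]
    exact div_pos_of_neg_of_neg (neg_neg_of_pos (hJ x (v x))) (by rw [he]; exact neg_neg_of_pos hs)
  have hvc : ∀ s : Set ℝ, (∀ x ∈ s, x ≠ 0) → ContinuousOn (fun x ↦ g x (v x)) s := by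
    intro s hs
    refine hgc.comp_continuousOn (continuousOn_id.prodMk ?_)
    exact ContinuousOn.div (by fun_prop) (by fun_prop) fun x hx ↦ by simpa using hs x hx
  have hv₁ : StrictMonoOn (fun x ↦ g x (v x)) (Set.Ioc 0 x₁) := by
    refine strictMonoOn_of_deriv_pos (convex_Ioc _ _) (hvc _ fun x hx ↦ hx.1.ne') fun x hx ↦ ?_
    rw [interior_Ioc] at hx
    exact hv_deriv x ⟨hx₂.trans hx.1, hx.2⟩ hx.1.ne'
  have hv₂ : StrictMonoOn (fun x ↦ g x (v x)) (Set.Ico x₂ 0) := by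
    refine strictMonoOn_of_deriv_pos (convex_Ico _ _) (hvc _ fun x hx ↦ hx.2.ne) fun x hx ↦ ?_
    rw [interior_Ico] at hx
    exact hv_deriv x ⟨hx.1, hx.2.trans hx₁⟩ hx.2.ne
  have hmeet : ∀ x ∈ Set.Icc x₂ x₁, x ≠ 0 → D x = 0 → v x = u x := by
    intro x hx h0 hDx
    have h1 := hu_eq x hx
    have h2 := hv_eq x h0
    rw [hDx, Real.sqrt_zero] at h1 h2
    have : x * (v x - u x) = 0 := by linarith
    have : v x - u x = 0 := by simpa [h0] using this
    linarith
  have hm₁ := hmeet x₁ ⟨by linarith, le_rfl⟩ hx₁.ne' hD₁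
  have hm₂ := hmeet x₂ ⟨le_rfl, by linarith⟩ hx₂.ne hD₂
  have hclass : ∀ x y, x * y ^ 2 + β * y + α.eval x = c →
      (x ∈ Set.Icc x₂ x₁ ∧ y = u x) ∨ (x ∈ Set.Ioo 0 x₁ ∧ y = v x) ∨
        (x ∈ Set.Ioo x₂ 0 ∧ y = v x) := by
    intro x y hxy
    have hw : (2 * x * y + β) ^ 2 = D x := by
      simp only [hD]
      rw [← hxy]
      ring
    have hD0 : 0 ≤ D x := hw ▸ sq_nonneg _
    have hmem : x ∈ Set.Icc x₂ x₁ := by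
      constructor
      · by_contra! h
        exact absurd (hneg₂ x h) (not_lt.mpr hD0)
      · by_contra! h
        exact absurd (hneg₁ x h) (not_lt.mpr hD0)
    rcases le_or_gt 0 (2 * x * y + β) with hsign | hsign
    · left
      refine ⟨hmem, ?_⟩
      have h1 : √(D x) = 2 * x * y + β := by rw [← hw, Real.sqrt_sq hsign]
      simp only [hu]
      rw [eq_div_iff (hden x).ne', h1, ← hxy]
      ring
    · right
      have h1 : √(D x) = -(2 * x * y + β) := by
        rw [← hw, ← neg_sq, Real.sqrt_sq (by linarith)]
      have hx0 : x ≠ 0 := by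
        rintro rfl
        linarith
      have hyv : y = v x := by
        simp only [hv]
        rw [h1]
        field_simp
        ring
      have hD' : D x ≠ 0 := by
        rw [← hw]
        exact pow_ne_zero _ hsign.ne
      rcases lt_or_gt_of_ne hx0 with h | h
      · right
        refine ⟨⟨hmem.1.lt_of_ne ?_, h⟩, hyv⟩
        rintro rfl
        exact hD' hD₂
      · left
        refine ⟨⟨h, hmem.2.lt_of_ne ?_⟩, hyv⟩
        rintro rfl
        exact hD' hD₁
  have hle₁ : ∀ x ∈ Set.Icc x₂ x₁, g x₁ (u x₁) ≤ g x (u x) := fun x hx ↦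
    hu_anti.antitoneOn hx ⟨by linarith, le_rfl⟩ hx.2
  have hle₂ : ∀ x ∈ Set.Icc x₂ x₁, g x (u x) ≤ g x₂ (u x₂) := fun x hx ↦
    hu_anti.antitoneOn ⟨le_rfl, by linarith⟩ hx hx.1
  have hlt₁ : ∀ x ∈ Set.Ioo 0 x₁, g x (v x) < g x₁ (u x₁) := fun x hx ↦ by
    rw [← hm₁]
    exact hv₁ ⟨hx.1, hx.2.le⟩ ⟨hx₁, le_rfl⟩ hx.2
  have hlt₂ : ∀ x ∈ Set.Ioo x₂ 0, g x₂ (u x₂) < g x (v x) := fun x hx ↦ by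
    rw [← hm₂]
    exact hv₂ ⟨le_rfl, hx₂⟩ ⟨hx.1.le, hx.2⟩ hx.1
  have h12 := hle₁ x₂ ⟨le_rfl, by linarith⟩
  rcases hclass xP yP hP with ⟨mP, rfl⟩ | ⟨mP, rfl⟩ | ⟨mP, rfl⟩ <;>
    rcases hclass xQ yQ hQ with ⟨mQ, rfl⟩ | ⟨mQ, rfl⟩ | ⟨mQ, rfl⟩
  · rw [hu_anti.injOn mP mQ hge]
  · linarith [hle₁ _ mP, hlt₁ _ mQ]
  · linarith [hle₂ _ mP, hlt₂ _ mQ]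
  · linarith [hle₁ _ mQ, hlt₁ _ mP]
  · rw [hv₁.injOn (Set.Ioo_subset_Ioc_self mP) (Set.Ioo_subset_Ioc_self mQ) hge]
  · linarith [hlt₁ _ mP, hlt₂ _ mQ]
  · linarith [hle₂ _ mQ, hlt₂ _ mP]
  · linarith [hlt₁ _ mQ, hlt₂ _ mP]
  · rw [hv₂.injOn (Set.Ioo_subset_Ico_self mP) (Set.Ioo_subset_Ico_self mQ) hge]

lemma injective_of_even (ho : IsOpenMap (toMap F G)) {k r : ℝ[X]} {b c : ℝ}
    (hbi : ∀ x y, bi F x (y + k.eval x) = r.eval x + (c + b * x) * y ^ 2)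
    (hne : ∀ x y, r.derivative.eval x + b * y ^ 2 ≠ 0) : Function.Injective (toMap F G) := by
  let e : ℝ × ℝ ≃ₜ ℝ × ℝ :=
    { toFun := fun P ↦ (P.1, P.2 + k.eval P.1)
      invFun := fun P ↦ (P.1, P.2 - k.eval P.1)
      left_inv := fun P ↦ by simp
      right_inv := fun P ↦ by simp
      continuous_toFun := by fun_prop
      continuous_invFun := by fun_prop }
  let s : ℝ → ℝ[X] := fun y ↦ r + Polynomial.C (b * y ^ 2) * Polynomial.X + Polynomial.C (c * y ^ 2)
  have hs : ∀ x y, bi F (e (x, y)).1 (e (x, y)).2 = (s y).eval x := fun x y ↦ by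
    refine (hbi x y).trans ?_
    simp [s]
    ring
  have hs' : ∀ x y, (s y).derivative.eval x = r.derivative.eval x + b * y ^ 2 := fun x y ↦ by
    simp [s, Polynomial.derivative_pow]
  have hc : (∀ x y, 0 < r.derivative.eval x + b * y ^ 2) ∨
      ∀ x y, r.derivative.eval x + b * y ^ 2 < 0 := by
    by_contra! hcon
    obtain ⟨⟨x₁, y₁, h₁⟩, x₂, y₂, h₂⟩ := hcon
    have hcont : Continuous fun P : ℝ × ℝ ↦ r.derivative.eval P.1 + b * P.2 ^ 2 := by fun_prop
    obtain ⟨P, hP⟩ := mem_range_of_exists_le_of_exists_ge hcont ⟨(x₁, y₁), h₁⟩ ⟨(x₂, y₂), h₂⟩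
    exact hne _ _ hP
  refine injective_of_homeomorph ho e ?_ ?_
  · simp only [hs]
    rcases hc with hc | hc
    · exact Or.inl fun y ↦ strictMono_of_deriv_pos fun x ↦ by
        rw [Polynomial.deriv, hs']; exact hc x y
    · exact Or.inr fun y ↦ strictAnti_of_deriv_neg fun x ↦ by
        rw [Polynomial.deriv, hs']; exact hc x y
  · simp only [hs]
    exact fun y ↦ surjective_of_derivative fun x ↦ by rw [hs']; exact hne x y

lemma bi_of_quadratic (hF : Supp F fun _ j ↦ j ≤ 2) (x y : ℝ) :
    bi F x y = (F 0).eval x + (F 1).eval x * y + (F 2).eval x * y ^ 2 := by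
  simp [bi, Finset.sum_range_succ, hF.eq_zero (j := 3) (by omega),
    hF.eq_zero (j := 4) (by omega), hF.eq_zero (j := 5) (by omega), hF.eq_zero (j := 6) (by omega)]

lemma bi_dx_of_quadratic (hF : Supp F fun _ j ↦ j ≤ 2) (x y : ℝ) :
    bi (dx F) x y = (F 0).derivative.eval x + (F 1).derivative.eval x * y
      + (F 2).derivative.eval x * y ^ 2 :=
  bi_of_quadratic hF.dx x y

lemma bi_dy_of_quadratic (hF : Supp F fun _ j ↦ j ≤ 2) (x y : ℝ) :
    bi (dy F) x y = (F 1).eval x + 2 * (F 2).eval x * y := by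
  rw [bi_of_quadratic (hF.dy.mono (by omega))]
  simp [dy, hF.eq_zero (j := 3) (by omega)]
  norm_num

/-- Injectivity when `f` is quadratic in `y` with constant leading coefficient. -/
theorem injective_of_quadratic (hJ : ∀ x y, 0 < jac F G x y)
    (hF : Supp F fun i j ↦ i + j ≤ 6 ∧ j ≤ 2) (hG : Supp G fun i j ↦ i + j ≤ 6)
    {c : ℝ} (hc : c ≠ 0) (h2 : F 2 = Polynomial.C c) : Function.Injective (toMap F G) := by
  have hF' : Supp F fun _ j ↦ j ≤ 2 := hF.mono (by omega)
  have hk : ∀ x, (Polynomial.C (-1 / (2 * c)) * F 1).eval x = -(F 1).eval x / (2 * c) := fun x ↦ by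
    simp; ring
  have hd : ∀ x, (F 0 + F 1 * (Polynomial.C (-1 / (4 * c)) * F 1)).derivative.eval x
      = bi (dx F) x (-(F 1).eval x / (2 * c)) := fun x ↦ by
    rw [bi_dx_of_quadratic hF', h2]
    simp
    field_simp
    ring
  refine injective_of_even (isOpenMap_toMap (hF.mono (by omega)) hG hJ)
    (k := Polynomial.C (-1 / (2 * c)) * F 1) (r := F 0 + F 1 * (Polynomial.C (-1 / (4 * c)) * F 1))
    (b := 0) (c := c) (fun x y ↦ ?_) (fun x y h0 ↦ ?_)
  · rw [bi_of_quadratic hF', hk, h2]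
    simp
    field_simp
    ring
  · rw [hd, zero_mul, add_zero] at h0
    have := hJ x (-(F 1).eval x / (2 * c))
    rw [jac, h0, bi_dy_of_quadratic hF', h2, Polynomial.eval_C,
      show (F 1).eval x + 2 * c * (-(F 1).eval x / (2 * c)) = 0 by field_simp; ring] at this
    simp at this

/-- The substitution `y ↦ y + k(x)` for polynomials of degree at most three in `y`. -/
noncomputable def shear (k : ℝ[X]) (F : ℕ → ℝ[X]) : ℕ → ℝ[X]
  | 0 => F 0 + k * F 1 + k ^ 2 * F 2 + k ^ 3 * F 3
  | 1 => F 1 + 2 * k * F 2 + 3 * k ^ 2 * F 3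
  | 2 => F 2 + 3 * k * F 3
  | 3 => F 3
  | _ => 0

lemma bi_of_cubic (hF : Supp F fun _ j ↦ j ≤ 3) (x y : ℝ) :
    bi F x y = (F 0).eval x + (F 1).eval x * y + (F 2).eval x * y ^ 2 + (F 3).eval x * y ^ 3 := by
  simp [bi, Finset.sum_range_succ,
    hF.eq_zero (j := 4) (by omega), hF.eq_zero (j := 5) (by omega), hF.eq_zero (j := 6) (by omega)]

lemma shear_supp (k : ℝ[X]) : Supp (shear k F) fun _ j ↦ j ≤ 3 := by
  intro i j hij
  by_contra! h
  obtain ⟨n, rfl⟩ : ∃ n, j = n + 4 := ⟨j - 4, by omega⟩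
  simp [shear] at hij

lemma jac_shear (hF : Supp F fun _ j ↦ j ≤ 3) (hG : Supp G fun _ j ↦ j ≤ 3) (k : ℝ[X]) (x y : ℝ) :
    jac (shear k F) (shear k G) x y = jac F G x (y + k.eval x) := by
  have h1 : ∀ {H : ℕ → ℝ[X]}, Supp H (fun _ j ↦ j ≤ 3) → ∀ x y, bi (dy (shear k H)) x y
      = bi (dy H) x (y + k.eval x) := by
    intro H hH x y
    rw [bi_of_cubic ((shear_supp k).dy.mono (by omega)), bi_of_cubic (hH.dy.mono (by omega))]
    simp [dy, shear, hH.eq_zero (j := 4) (by omega)]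
    ring
  have h2 : ∀ {H : ℕ → ℝ[X]}, Supp H (fun _ j ↦ j ≤ 3) → ∀ x y, bi (dx (shear k H)) x y
      = bi (dx H) x (y + k.eval x) + k.derivative.eval x * bi (dy H) x (y + k.eval x) := by
    intro H hH x y
    rw [bi_of_cubic (shear_supp k).dx, bi_of_cubic hH.dx, bi_of_cubic (hH.dy.mono (by omega))]
    simp [dx, dy, shear, hH.eq_zero (j := 4) (by omega), Polynomial.derivative_pow]
    ring
  rw [jac, jac, h1 hF, h1 hG, h2 hF, h2 hG]
  ring

lemma shear_weight {k : ℝ[X]} (hk : k.natDegree ≤ 2) (hF : Supp F fun i j ↦ i + 2 * j ≤ 6) :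
    Supp (shear k F) fun i j ↦ i + 2 * j ≤ 6 := by
  have hn : ∀ j n, n + 2 * j = 6 → (F j).natDegree ≤ n := fun j n h ↦ hF.natDegree_le (by omega)
  have h0 := hn 0 6 rfl
  have h1 := hn 1 4 rfl
  have h2 := hn 2 2 rfl
  have h3 := hn 3 0 rfl
  have hkk : ∀ m, (k ^ m).natDegree ≤ m * 2 := fun m ↦ Polynomial.natDegree_pow_le_of_le m hk
  have key : ∀ j n, n + 2 * j = 6 → (shear k F j).natDegree ≤ n := by
    intro j n h
    have hj : j ≤ 3 := by omega
    interval_cases j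
    · obtain rfl : n = 6 := by omega
      refine Polynomial.natDegree_add_le_of_degree_le (Polynomial.natDegree_add_le_of_degree_le
        (Polynomial.natDegree_add_le_of_degree_le h0 ?_) ?_) ?_
      · exact (Polynomial.natDegree_mul_le_of_le hk h1)
      · exact (Polynomial.natDegree_mul_le_of_le (hkk 2) h2)
      · exact (Polynomial.natDegree_mul_le_of_le (hkk 3) h3)
    · obtain rfl : n = 4 := by omega
      refine Polynomial.natDegree_add_le_of_degree_le
        (Polynomial.natDegree_add_le_of_degree_le h1 ?_) ?_
      · have : (2 * k).natDegree ≤ 2 := by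
          refine (Polynomial.natDegree_mul_le_of_le (m := 0) (n := 2) ?_ hk)
          exact (Polynomial.natDegree_ofNat 2).le
        exact (Polynomial.natDegree_mul_le_of_le this h2)
      · have : (3 * k ^ 2).natDegree ≤ 4 := by
          refine (Polynomial.natDegree_mul_le_of_le (m := 0) (n := 4) ?_ (hkk 2))
          exact (Polynomial.natDegree_ofNat 3).le
        exact (Polynomial.natDegree_mul_le_of_le this h3)
    · obtain rfl : n = 2 := by omega
      refine Polynomial.natDegree_add_le_of_degree_le h2 ?_
      have : (3 * k).natDegree ≤ 2 := by
        refine (Polynomial.natDegree_mul_le_of_le (m := 0) (n := 2) ?_ hk)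
        exact (Polynomial.natDegree_ofNat 3).le
      exact (Polynomial.natDegree_mul_le_of_le this h3)
    · obtain rfl : n = 0 := by omega
      exact h3
  intro i j hij
  have hj := shear_supp k i j hij
  by_contra! hlt
  refine hij (Polynomial.coeff_eq_zero_of_natDegree_lt ((key j (6 - 2 * j) (by omega)).trans_lt ?_))
  omega

lemma eq_zero_of_sq_le {P Q : ℝ} (h : P ^ 2 - P * Q + Q ^ 2 ≤ 0) : P = 0 ∧ Q = 0 := by
  constructor
  · exact pow_eq_zero_iff two_ne_zero |>.mp (by nlinarith [sq_nonneg (2 * Q - P), sq_nonneg P])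
  · exact pow_eq_zero_iff two_ne_zero |>.mp (by nlinarith [sq_nonneg (2 * P - Q), sq_nonneg Q])

/-- No pair has `f = b x y ^ 2 + β y + c` and partner of weight at most six for the
weights `(1, 2)`. -/
lemma not_pos_of_hyperbolic (hJ : ∀ x y, 0 < jac F G x y)
    (hF : Supp F fun i j ↦ i = 1 ∧ j = 2 ∨ i = 0 ∧ j = 1 ∨ i = 0 ∧ j = 0)
    (hG : Supp G fun i j ↦ i + 2 * j ≤ 6) (hb : (F 2).coeff 1 ≠ 0) (hβ : (F 1).coeff 0 ≠ 0) :
    False := by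
  have h6 : (G 0).coeff 6 = 0 := by
    have h := jac_lead_nonneg_of_finset hJ (hF.mono (by omega)) (hG.mono (by omega)) 1 (-1) (-1) 6
      (S := {(1, 2), (0, 1)}) (T := {(6, 0)}) (by simp) (by simp)
      (hF.mono (by simp; omega)) (hG.mono (by simp; omega))
    simp at h
    have h1 := h 1 0
    have h2 := h (-1) 0
    norm_num at h1 h2
    have : (F 1).coeff 0 * (G 0).coeff 6 = 0 := by linarith
    simpa [hβ] using this
  replace hG := hG.erase h6
  have h5 : (G 0).coeff 5 = 0 := by
    have h := jac_lead_nonneg_of_finset hJ (hF.mono (by omega)) (hG.mono (by omega)) 1 (-1) (-1) 5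
      (S := {(1, 2), (0, 1)}) (T := {(5, 0)}) (by simp) (by simp)
      (hF.mono (by simp; omega)) (hG.mono (by simp; omega))
    simp at h
    have := quadratic_nonneg (A := -(5 * ((F 1).coeff 0 * (G 0).coeff 5)))
      (B := -(10 * ((F 2).coeff 1 * (G 0).coeff 5))) (C := 0) fun z ↦ by
        have := h 1 z
        norm_num at this
        linarith
    have : (F 2).coeff 1 * (G 0).coeff 5 = 0 := by nlinarith
    simpa [hb] using this
  replace hG := hG.erase h5
  have h4 : (G 0).coeff 4 = 0 := by
    have h := jac_lead_nonneg_of_finset hJ (hF.mono (by omega)) (hG.mono (by omega)) 1 (-1) (-1) 4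
      (S := {(1, 2), (0, 1)}) (T := {(4, 0)}) (by simp) (by simp)
      (hF.mono (by simp; omega)) (hG.mono (by simp; omega))
    simp at h
    have h1 := h 1 0
    have h2 := h (-1) 0
    norm_num at h1 h2
    have : (F 1).coeff 0 * (G 0).coeff 4 = 0 := by linarith
    simpa [hβ] using this
  replace hG := hG.erase h4
  have h3 : (G 0).coeff 3 = 0 ∧ (G 1).coeff 4 = 0 := by
    have h := jac_lead_nonneg_of_finset hJ (hF.mono (by omega)) (hG.mono (by omega)) 1 (-1) (-1) 3
      (S := {(1, 2), (0, 1)}) (T := {(3, 0), (4, 1)}) (by simp) (by simp)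
      (hF.mono (by simp; omega)) (hG.mono (by simp; omega))
    simp at h
    have := quadratic_nonneg (A := -(3 * ((F 1).coeff 0 * (G 0).coeff 3)))
      (B := -(6 * ((F 2).coeff 1 * (G 0).coeff 3) + 4 * ((F 1).coeff 0 * (G 1).coeff 4)))
      (C := -(7 * ((F 2).coeff 1 * (G 1).coeff 4))) fun z ↦ by
        have := h 1 z
        norm_num at this
        linarith
    have e1 : ((F 2).coeff 1 * (G 0).coeff 3) ^ 2 = 0 := by
      nlinarith [sq_nonneg (8 * ((F 1).coeff 0 * (G 1).coeff 4) - 9 * ((F 2).coeff 1 * (G 0).coeff 3)),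
        sq_nonneg ((F 2).coeff 1 * (G 0).coeff 3)]
    have e2 : (G 0).coeff 3 = 0 := by simpa [hb] using e1
    rw [e2] at this
    have e3 : ((F 1).coeff 0 * (G 1).coeff 4) ^ 2 = 0 := by
      nlinarith [sq_nonneg ((F 1).coeff 0 * (G 1).coeff 4)]
    exact ⟨e2, by simpa [hβ] using e3⟩
  replace hG := (hG.erase h3.1).erase h3.2
  have h2 : (G 0).coeff 2 = 0 ∧ (G 1).coeff 3 = 0 := by
    have h := jac_lead_nonneg_of_finset hJ (hF.mono (by omega)) (hG.mono (by omega)) 1 (-1) (-1) 2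
      (S := {(1, 2), (0, 1)}) (T := {(2, 0), (3, 1)}) (by simp) (by simp)
      (hF.mono (by simp; omega)) (hG.mono (by simp; omega))
    simp at h
    have h1 := h 1 0
    have h2 := h (-1) 0
    have h3 := h 1 1
    have h4 := h (-1) (-1)
    have h5 := h 1 (-1)
    have h6 := h (-1) 1
    norm_num at h1 h2 h3 h4 h5 h6
    have e1 : (F 1).coeff 0 * (G 0).coeff 2 = 0 := by linarith
    have e2 : (G 0).coeff 2 = 0 := by simpa [hβ] using e1
    rw [e2] at h3 h4 h5 h6
    have e3 : (F 2).coeff 1 * (G 1).coeff 3 = 0 := by linarith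
    exact ⟨e2, by simpa [hb] using e3⟩
  replace hG := (hG.erase h2.1).erase h2.2
  have h := jac_lead_nonneg_of_finset hJ (hF.mono (by omega)) (hG.mono (by omega)) 1 (-1) (-1) 1
    (S := {(1, 2), (0, 1)}) (T := {(1, 0), (2, 1)}) (by simp) (by simp)
    (hF.mono (by simp; omega)) (hG.mono (by simp; omega))
  simp at h
  have := quadratic_nonneg (A := -((F 1).coeff 0 * (G 0).coeff 1))
    (B := -(2 * ((F 2).coeff 1 * (G 0).coeff 1) + 2 * ((F 1).coeff 0 * (G 1).coeff 2)))
    (C := -(3 * ((F 2).coeff 1 * (G 1).coeff 2))) fun z ↦ by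
      have := h 1 z
      norm_num at this
      linarith
  have := (eq_zero_of_sq_le (P := (F 2).coeff 1 * (G 0).coeff 1)
    (Q := (F 1).coeff 0 * (G 1).coeff 2) (by nlinarith)).1
  have hp : (G 0).coeff 1 = 0 := by simpa [hb] using this
  have := hJ 0 0
  have f0 : (F 0).coeff 1 = 0 := hF.coeff_eq_zero (by omega)
  simp [jac, bi, dx, dy, Finset.sum_range_succ, ← Polynomial.coeff_zero_eq_eval_zero,
    Polynomial.coeff_derivative, hp, f0] at this

lemma quadratic_nonneg_of_sq_mul {A B C : ℝ} (h : ∀ z, 0 ≤ z ^ 2 * (A + B * z + C * z ^ 2)) :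
    B ^ 2 ≤ 4 * A * C := by
  refine quadratic_nonneg fun z ↦ ?_
  have hcl : IsClosed {z : ℝ | 0 ≤ A + B * z + C * z ^ 2} :=
    isClosed_le continuous_const (by fun_prop)
  have hsub : ({0}ᶜ : Set ℝ) ⊆ {z : ℝ | 0 ≤ A + B * z + C * z ^ 2} := fun z hz ↦
    nonneg_of_mul_nonneg_right (h z) (by have : z ≠ 0 := hz; positivity)
  exact hcl.closure_subset_iff.mpr hsub ((dense_compl_singleton (0 : ℝ)) z)

/-- The coefficient conditions forcing the partner into weight at most six. -/
lemma supp_of_square (hJ : ∀ x y, 0 < jac F G x y)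
    (hF : Supp F fun i j ↦ i ≤ 5 ∧ j = 0 ∨ i ≤ 3 ∧ j = 1 ∨ i ≤ 1 ∧ j = 2)
    (hG : Supp G fun i j ↦ i + j ≤ 6 ∧ (j = 0 ∨ j = 1 ∧ i ≤ 4 ∨ j = 2 ∧ i ≤ 3 ∨ j = 3 ∧ i ≤ 2 ∨
      j = 4 ∧ i = 0)) (hb : (F 2).coeff 1 ≠ 0)
    (hA : 4 * (F 2).coeff 1 * (F 0).coeff 5 = (F 1).coeff 3 ^ 2) (ht : (F 1).coeff 3 ≠ 0) :
    Supp G fun i j ↦ i + 2 * j ≤ 6 := by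
  have h8 : (G 4).coeff 0 = 0 ∧ (G 3).coeff 2 = 0 := by
    have h := jac_lead_nonneg_of_finset hJ (hF.mono (by omega)) (hG.mono (by omega)) 1 2 5 8
      (S := {(1, 2), (3, 1), (5, 0)}) (T := {(0, 4), (2, 3)}) (by simp) (by simp)
      (hF.mono (by simp; omega)) (hG.mono (by simp; omega))
    simp at h
    have h1 := h 0 1
    have h2 := h 0 (-1)
    norm_num at h1 h2
    have e1 : (F 2).coeff 1 * (G 4).coeff 0 = 0 := by linarith
    have e2 : (G 4).coeff 0 = 0 := by simpa [hb] using e1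
    refine ⟨e2, ?_⟩
    have := quadratic_nonneg_of_sq_mul (A := 15 * ((F 0).coeff 5 * (G 3).coeff 2))
      (B := 7 * ((F 1).coeff 3 * (G 3).coeff 2)) (C := -((F 2).coeff 1 * (G 3).coeff 2)) fun z ↦ by
        have := h 1 z
        norm_num [e2] at this
        linarith
    have e3 : ((F 1).coeff 3 * (G 3).coeff 2) ^ 2 = 0 := by
      have : (4 * (F 2).coeff 1 * (F 0).coeff 5) * (G 3).coeff 2 ^ 2
        = (F 1).coeff 3 ^ 2 * (G 3).coeff 2 ^ 2 := by rw [hA]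
      nlinarith [sq_nonneg ((F 1).coeff 3 * (G 3).coeff 2)]
    simpa [ht] using e3
  replace hG := (hG.erase h8.1).erase h8.2
  have h7 : (G 3).coeff 1 = 0 ∧ (G 2).coeff 3 = 0 := by
    have h := jac_lead_nonneg_of_finset hJ (hF.mono (by omega)) (hG.mono (by omega)) 1 2 5 7
      (S := {(1, 2), (3, 1), (5, 0)}) (T := {(1, 3), (3, 2)}) (by simp) (by simp)
      (hF.mono (by simp; omega)) (hG.mono (by simp; omega))
    simp at h
    have a1 := h 1 1
    have a2 := h 1 (-1)
    have a3 := h 1 2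
    have a4 := h 1 (-2)
    have b1 := h (-1) 1
    have b2 := h (-1) (-1)
    have b3 := h (-1) 2
    have b4 := h (-1) (-2)
    norm_num at a1 a2 a3 a4 b1 b2 b3 b4
    have e1 : (F 2).coeff 1 * (G 3).coeff 1 = 0 := by linarith
    have e2 : (G 3).coeff 1 = 0 := by simpa [hb] using e1
    rw [e2] at a1 a2 a3 a4 b1 b2 b3 b4
    have e3 : (F 2).coeff 1 * (G 2).coeff 3 = 0 := by linarith
    exact ⟨e2, by simpa [hb] using e3⟩
  exact ((hG.erase h7.1).erase h7.2).mono (by omega)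

/-- Injectivity when `f` is quadratic in `y` with leading coefficient a multiple of `x`. -/
lemma injective_of_linear_quadratic (hJ : ∀ x y, 0 < jac F G x y)
    (hF : Supp F fun i j ↦ i ≤ 5 ∧ j = 0 ∨ i ≤ 3 ∧ j = 1 ∨ i = 1 ∧ j = 2)
    (hG : Supp G fun i j ↦ i + j ≤ 6 ∧ (j = 0 ∨ j = 1 ∧ i ≤ 4 ∨ j = 2 ∧ i ≤ 3 ∨ j = 3 ∧ i ≤ 2 ∨
      j = 4 ∧ i = 0)) (hA : (F 0).coeff 5 ≠ 0) {b : ℝ} (hb : b ≠ 0)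
    (hF2 : F 2 = Polynomial.C b * Polynomial.X) : Function.Injective (toMap F G) := by
  have hF' : Supp F fun _ j ↦ j ≤ 2 := hF.mono (by omega)
  have hG6 : Supp G fun i j ↦ i + j ≤ 6 := hG.mono (by omega)
  have ho := isOpenMap_toMap (hF.mono (by omega)) hG6 hJ
  set β := (F 1).coeff 0 with hβ
  set q := (F 1).divX with hq
  have hF1 : F 1 = Polynomial.X * q + Polynomial.C β := ((F 1).X_mul_divX_add).symm
  set k : ℝ[X] := Polynomial.C (-1 / (2 * b)) * q with hk
  set α : ℝ[X] := F 0 + F 1 * k + F 2 * k ^ 2 with hα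
  have hkey : F 1 + 2 * F 2 * k = Polynomial.C β := by
    rw [hF1, hF2, hk]
    have : Polynomial.C b * Polynomial.C (-1 / (2 * b)) * 2 = (-1 : ℝ[X]) := by
      rw [← Polynomial.C_mul, ← map_ofNat Polynomial.C, ← Polynomial.C_mul]
      field_simp
      simp
    linear_combination Polynomial.X * q * this
  have hkx : ∀ x, (F 1).eval x + 2 * (b * x) * k.eval x = β := fun x ↦ by
    have := congrArg (Polynomial.eval x) hkey
    simpa [hF2] using this
  have hkx' : ∀ x, (F 1).derivative.eval x + 2 * b * k.eval x
      + 2 * (b * x) * k.derivative.eval x = 0 := fun x ↦ by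
    have := congrArg (fun p ↦ Polynomial.eval x (Polynomial.derivative p)) hkey
    simp [hF2] at this
    linarith
  have hbi : ∀ x y, bi F x (y + k.eval x) = α.eval x + β * y + b * x * y ^ 2 := fun x y ↦ by
    rw [bi_of_quadratic hF', ← hkx x, hα, hF2]
    simp
    ring
  have hbx : ∀ x y, bi (dx F) x (y + k.eval x) + k.derivative.eval x * bi (dy F) x (y + k.eval x)
      = α.derivative.eval x + b * y ^ 2 := fun x y ↦ by
    rw [bi_dx_of_quadratic hF', bi_dy_of_quadratic hF', hα, hF2]
    simp [Polynomial.derivative_pow]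
    linear_combination y * hkx' x
  have hby : ∀ x y, bi (dy F) x (y + k.eval x) = β + 2 * (b * x) * y := fun x y ↦ by
    rw [bi_dy_of_quadratic hF', hF2]
    simp
    linear_combination hkx x
  have hJ' : ∀ x y, 0 < (α.derivative.eval x + b * y ^ 2) * bi (dy G) x (y + k.eval x)
      - (β + 2 * (b * x) * y) * (bi (dx G) x (y + k.eval x)
        + k.derivative.eval x * bi (dy G) x (y + k.eval x)) := fun x y ↦ by
    have := hJ x (y + k.eval x)
    rw [jac] at this
    rw [← hbx, ← hby]
    linarith
  rcases eq_or_ne β 0 with h0 | h0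
  · have hr : ∀ x, α.derivative.eval x ≠ 0 := fun x hx ↦ by
      have := hJ' x 0
      simp [hx, h0] at this
    have hr0 : 0 < b * α.derivative.eval 0 := by
      by_contra! hle
      obtain ⟨y, hy⟩ : ∃ y : ℝ, y ^ 2 = -α.derivative.eval 0 / b := by
        refine ⟨√(-α.derivative.eval 0 / b), Real.sq_sqrt ?_⟩
        have : -α.derivative.eval 0 / b = -(b * α.derivative.eval 0) / b ^ 2 := by field_simp
        rw [this]
        exact div_nonneg (by linarith) (sq_nonneg b)
      have := hJ' 0 y
      rw [hy, mul_div_cancel₀ _ hb, h0] at this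
      simp at this
    have hrb : ∀ x, 0 < b * α.derivative.eval x := fun x ↦ by
      by_contra! hle
      have hcont : Continuous fun x ↦ b * α.derivative.eval x := by fun_prop
      obtain ⟨z, hz⟩ := mem_range_of_exists_le_of_exists_ge hcont ⟨x, hle⟩ ⟨0, hr0.le⟩
      exact mul_ne_zero hb (hr z) hz
    refine injective_of_even ho (k := k) (r := α) (b := b) (c := 0) (fun x y ↦ ?_) fun x y hxy ↦ ?_
    · rw [hbi, h0]
      ring
    · have h1 : b * (α.derivative.eval x + b * y ^ 2) = 0 := by rw [hxy, mul_zero]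
      nlinarith [hrb x, sq_nonneg (b * y)]
  by_cases hdeg : 0 < α.degree
  · obtain ⟨ε, hε, hpos⟩ : ∃ ε : ℝ, ε ^ 2 = 1 ∧ 0 < ε * (β / b) := by
      rcases lt_or_gt_of_ne (div_ne_zero h0 hb) with h | h
      · exact ⟨-1, by norm_num, by linarith⟩
      · exact ⟨1, by norm_num, by linarith⟩
    have hdeg' : 0 < (Polynomial.C b⁻¹ * α).degree := by
      rwa [Polynomial.degree_C_mul (inv_ne_zero hb)]
    have hinj := injective_of_loop_of_pos hdeg' hpos
      (g := fun x y ↦ ε * b * bi G x (ε * y + k.eval x))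
      (gx := fun x y ↦ ε * b * (bi (dx G) x (ε * y + k.eval x)
        + k.derivative.eval x * bi (dy G) x (ε * y + k.eval x)))
      (gy := fun x y ↦ b * bi (dy G) x (ε * y + k.eval x)) ?_ ?_
    · intro P Q hPQ
      simp only [toMap, Prod.mk.injEq] at hPQ
      have hε' : ∀ z, ε * (ε * z) = z := fun z ↦ by rw [← mul_assoc, ← sq, hε, one_mul]
      have hPe : ∀ P : ℝ × ℝ, bi F P.1 P.2 = b * (P.1 * (ε * (P.2 - k.eval P.1)) ^ 2
          + ε * (β / b) * (ε * (P.2 - k.eval P.1)) + (Polynomial.C b⁻¹ * α).eval P.1) := fun P ↦ by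
        have := hbi P.1 (P.2 - k.eval P.1)
        rw [sub_add_cancel] at this
        rw [this, mul_pow, hε, mul_right_comm ε, hε']
        simp
        field_simp
        ring
      have := @hinj (P.1, ε * (P.2 - k.eval P.1)) (Q.1, ε * (Q.2 - k.eval Q.1)) (by
        simp only [hε', sub_add_cancel, hPQ.2, Prod.mk.injEq, and_true]
        have h := hPQ.1
        rw [hPe, hPe] at h
        exact mul_left_cancel₀ hb h)
      simp only [Prod.mk.injEq] at this
      have h1 := this.1
      have h2 := congrArg (ε * ·) this.2
      simp only [hε', h1] at h2
      exact Prod.ext h1 (by linarith)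
    · intro x y
      have h1 : HasFDerivAt (fun P : ℝ × ℝ ↦ P.1) (ContinuousLinearMap.fst ℝ ℝ ℝ) (x, y) :=
        hasFDerivAt_fst
      have h2 : HasFDerivAt (fun P : ℝ × ℝ ↦ P.2) (ContinuousLinearMap.snd ℝ ℝ ℝ) (x, y) :=
        hasFDerivAt_snd
      have h3 := (h2.const_mul ε).add ((k.hasDerivAt x).comp_hasFDerivAt (x, y) h1)
      have h4 := (hasStrictFDerivAt_bi hG6 (x, ε * y + k.eval x)).hasFDerivAt
      have h5 := (h4.comp (x, y) (h1.prodMk h3)).const_mul (ε * b)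
      refine h5.congr_fderiv ?_
      ext
      · simp
        ring
      · simp
        linear_combination b * bi (dy G) x (ε * y + k.eval x) * hε
    · intro x y
      have := hJ' x (ε * y)
      simp only [Polynomial.derivative_C_mul, Polynomial.eval_C_mul]
      refine this.trans_eq ?_
      have e : b * b⁻¹ = 1 := mul_inv_cancel₀ hb
      set M := bi (dx G) x (ε * y + k.eval x) + k.derivative.eval x * bi (dy G) x (ε * y + k.eval x)
      linear_combination (b * y ^ 2 * bi (dy G) x (ε * y + k.eval x) + β * M) * hε
        + (ε ^ 2 * β * M - α.derivative.eval x * bi (dy G) x (ε * y + k.eval x)) * e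
  · exfalso
    obtain ⟨c, hc⟩ : ∃ c, α = Polynomial.C c :=
      ⟨_, Polynomial.eq_C_of_degree_le_zero (not_lt.mp hdeg)⟩
    have hq2 : q.natDegree ≤ 2 := by
      have : (F 1).natDegree ≤ 3 := hF.natDegree_le (by omega)
      rw [hq, Polynomial.natDegree_divX_eq_natDegree_tsub_one]
      omega
    have hkq : Polynomial.C (2 * b) * k = -q := by
      rw [hk, ← mul_assoc, ← Polynomial.C_mul]
      field_simp
      simp
    have hid : Polynomial.C (4 * b) * α
        = Polynomial.C (4 * b) * F 0 - Polynomial.X * q ^ 2 - Polynomial.C (2 * β) * q := by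
      have h4 : Polynomial.C (4 * b) = Polynomial.C (2 * b) * 2 := by
        rw [← map_ofNat Polynomial.C, ← Polynomial.C_mul]
        ring_nf
      have h2 : Polynomial.C (2 * b) = 2 * Polynomial.C b := by
        rw [Polynomial.C_mul, map_ofNat]
      rw [hα, h4, hF1, hF2]
      rw [h2] at hkq ⊢
      simp only [Polynomial.C_mul, map_ofNat]
      linear_combination (2 * Polynomial.X * q + 2 * Polynomial.C β
        + Polynomial.X * (2 * Polynomial.C b * k - q)) * hkq
    have hA' : 4 * (F 2).coeff 1 * (F 0).coeff 5 = (F 1).coeff 3 ^ 2 := by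
      have := congrArg (fun p ↦ Polynomial.coeff p 5) hid
      simp only [hc, Polynomial.coeff_sub, Polynomial.coeff_C_mul, Polynomial.coeff_X_mul] at this
      have e2 : (q ^ 2).coeff 4 = (F 1).coeff 3 ^ 2 := by
        have := Polynomial.coeff_pow_of_natDegree_le (m := 2) hq2
        rw [hq, Polynomial.coeff_divX] at this
        exact this
      rw [e2, Polynomial.coeff_eq_zero_of_natDegree_lt (hq2.trans_lt (by norm_num)),
        Polynomial.coeff_C_of_ne_zero (by norm_num)] at this
      rw [hF2]
      simp
      linarith
    have hb' : (F 2).coeff 1 ≠ 0 := by rw [hF2]; simpa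
    have ht : (F 1).coeff 3 ≠ 0 := fun h ↦ by
      rw [h] at hA'
      have : (F 2).coeff 1 * (F 0).coeff 5 = 0 := by linarith
      exact mul_ne_zero hb' hA this
    have hGw := supp_of_square hJ (hF.mono (by omega)) hG hb' hA' ht
    have hk2 : k.natDegree ≤ 2 := (Polynomial.natDegree_C_mul_le _ _).trans hq2
    have hF3 : F 3 = 0 := hF.eq_zero (by omega)
    have s0 : shear k F 0 = Polynomial.C c := by
      rw [← hc, hα]
      simp only [shear, hF3]
      ring
    have s1 : shear k F 1 = Polynomial.C β := by
      rw [← hkey]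
      simp only [shear, hF3]
      ring
    have s2 : shear k F 2 = Polynomial.C b * Polynomial.X := by
      rw [← hF2]
      simp only [shear, hF3]
      ring
    have s3 : shear k F 3 = 0 := hF3
    refine not_pos_of_hyperbolic (F := shear k F) (G := shear k G) (fun x y ↦ ?_) ?_
      (shear_weight hk2 hGw) (by simpa [s2]) (by simpa [s1])
    · rw [jac_shear (hF.mono (by omega)) (hGw.mono (by omega))]
      exact hJ _ _
    · intro i j hij
      have hj := shear_supp k i j hij
      interval_cases j
      · rw [s0, Polynomial.coeff_C] at hij
        simp at hij
        omega
      · rw [s1, Polynomial.coeff_C] at hij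
        simp at hij
        omega
      · rw [s2, Polynomial.coeff_C_mul, Polynomial.coeff_X] at hij
        simp at hij
        omega
      · rw [s3] at hij
        simp at hij

/-- Injectivity when `f` is quadratic in `y` with leading coefficient of degree at most one. -/
theorem injective_of_degree_two (hJ : ∀ x y, 0 < jac F G x y)
    (hF : Supp F fun i j ↦ i ≤ 5 ∧ j = 0 ∨ i ≤ 3 ∧ j = 1 ∨ i ≤ 1 ∧ j = 2)
    (hG : Supp G fun i j ↦ i + j ≤ 6 ∧ (j = 0 ∨ j = 1 ∧ i ≤ 4 ∨ j = 2 ∧ i ≤ 3 ∨ j = 3 ∧ i ≤ 2 ∨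
      j = 4 ∧ i = 0)) (hA : (F 0).coeff 5 ≠ 0) : Function.Injective (toMap F G) := by
  have h2 : F 2 = Polynomial.C ((F 2).coeff 1) * Polynomial.X + Polynomial.C ((F 2).coeff 0) :=
    Polynomial.eq_X_add_C_of_natDegree_le_one (hF.natDegree_le (by omega))
  by_cases hb : (F 2).coeff 1 = 0
  · by_cases hc : (F 2).coeff 0 = 0
    · exact injective_of_affine hJ (((hF.erase hb).erase hc).mono (by omega)) hG
    · refine injective_of_quadratic hJ (hF.mono (by omega)) (hG.mono (by omega)) hc ?_
      rw [hb] at h2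
      simpa using h2
  · set s := -(F 2).coeff 0 / (F 2).coeff 1 with hs
    refine injective_of_shift s ?_
    have hJ' : ∀ x y, 0 < jac (shift s F) (shift s G) x y := fun x y ↦ by
      rw [jac_shift]; exact hJ _ _
    have e : shift s F 2 = Polynomial.C ((F 2).coeff 1) * Polynomial.X := by
      rw [shift, h2, Polynomial.taylor_apply]
      simp only [Polynomial.add_comp, Polynomial.mul_comp, Polynomial.C_comp, Polynomial.X_comp,
        Polynomial.coeff_add, Polynomial.coeff_C_mul, Polynomial.coeff_X_one, Polynomial.coeff_C]
      simp only [one_ne_zero, if_false, mul_one, add_zero]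
      rw [mul_add, ← Polynomial.C_mul, add_assoc, ← Polynomial.C_add, hs, mul_div_cancel₀ _ hb,
        neg_add_cancel, Polynomial.C_0, add_zero]
    have e0 : (shift s F 2).coeff 0 = 0 := by simp [e]
    refine injective_of_linear_quadratic hJ' (((hF.shift s (by omega)).erase e0).mono (by omega))
      (hG.shift s (by omega)) ?_ hb e
    rwa [coeff_shift_of_natDegree_le s (hF.natDegree_le (by omega))]

/-- Linear combinations of the components of a pair. -/
noncomputable def comb (a b : ℝ) (F G : ℕ → ℝ[X]) (j : ℕ) : ℝ[X] :=
  Polynomial.C a * F j + Polynomial.C b * G j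

lemma coeff_comb (a b : ℝ) (i j : ℕ) :
    (comb a b F G j).coeff i = a * (F j).coeff i + b * (G j).coeff i := by
  simp [comb]

lemma bi_comb (a b x y : ℝ) : bi (comb a b F G) x y = a * bi F x y + b * bi G x y := by
  simp only [bi, comb, Finset.mul_sum, ← Finset.sum_add_distrib, Polynomial.eval_add,
    Polynomial.eval_C_mul]
  exact Finset.sum_congr rfl fun j _ ↦ by ring

lemma jac_comb (a b c d x y : ℝ) :
    jac (comb a b F G) (comb c d F G) x y = (a * d - b * c) * jac F G x y := by
  have h1 : ∀ a b, dx (comb a b F G) = comb a b (dx F) (dx G) := fun a b ↦ by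
    ext1 j
    simp [dx, comb]
  have h2 : ∀ a b, dy (comb a b F G) = comb a b (dy F) (dy G) := fun a b ↦ by
    ext1 j
    simp only [dy, comb]
    ring
  simp only [jac, h1, h2, bi_comb]
  ring

lemma injective_of_comb (a b c d : ℝ)
    (h : Function.Injective (toMap (comb a b F G) (comb c d F G))) :
    Function.Injective (toMap F G) := fun P Q hPQ ↦ by
  simp only [toMap, Prod.mk.injEq] at hPQ
  exact h (by simp only [toMap, bi_comb, hPQ.1, hPQ.2])

lemma Supp.comb {P Q : ℕ → ℕ → Prop} (hF : Supp F P) (hG : Supp G Q) (a b : ℝ) :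
    Supp (comb a b F G) fun i j ↦ (a ≠ 0 ∧ P i j) ∨ (b ≠ 0 ∧ Q i j) := by
  intro i j hij
  rw [coeff_comb] at hij
  by_contra! hcon
  refine hij ?_
  have h1 : a * (F j).coeff i = 0 := by
    by_contra h
    exact hcon.1 (left_ne_zero_of_mul h) (hF _ _ (right_ne_zero_of_mul h))
  have h2 : b * (G j).coeff i = 0 := by
    by_contra h
    exact hcon.2 (left_ne_zero_of_mul h) (hG _ _ (right_ne_zero_of_mul h))
  rw [h1, h2, add_zero]

/-- Near a simple zero `s` of `γ`, the critical values of `α + β y + γ y ^ 2` in `y` vary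
monotonically. -/
lemma eventually_resultant_pos {α β γ : ℝ[X]} {s : ℝ} (hs : γ.eval s = 0)
    (hs' : 0 < γ.derivative.eval s)
    (h : β.eval s = 0 → ∀ y, α.derivative.eval s + β.derivative.eval s * y
      + γ.derivative.eval s * y ^ 2 ≠ 0) :
    ∀ᶠ x in 𝓝[≠] s, 0 < 4 * γ.eval x ^ 2 * α.derivative.eval x
      - 2 * γ.eval x * β.eval x * β.derivative.eval x + γ.derivative.eval x * β.eval x ^ 2 := by
  rcases eq_or_ne (β.eval s) 0 with h0 | h0
  · obtain ⟨β₁, hβ₁⟩ := Polynomial.dvd_iff_isRoot.mpr h0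
    obtain ⟨γ₁, hγ₁⟩ := Polynomial.dvd_iff_isRoot.mpr hs
    have hb : β.derivative.eval s = β₁.eval s := by rw [hβ₁]; simp
    have hg : γ.derivative.eval s = γ₁.eval s := by rw [hγ₁]; simp
    have hlt : β₁.eval s ^ 2 < 4 * γ₁.eval s * α.derivative.eval s := by
      by_contra! hle
      rw [← hb, ← hg] at hle
      obtain ⟨y, hy⟩ := exists_quadratic_eq_zero hs'.ne'
        (b := β.derivative.eval s) (c := α.derivative.eval s) (by
          refine ⟨√(discrim (γ.derivative.eval s) (β.derivative.eval s) (α.derivative.eval s)), ?_⟩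
          rw [Real.mul_self_sqrt]
          rw [discrim]
          linarith)
      exact h h0 y (by linarith)
    have hcont : Continuous fun x ↦ 4 * γ₁.eval x ^ 2 * α.derivative.eval x
      - 2 * γ₁.eval x * β₁.eval x * β.derivative.eval x + γ.derivative.eval x * β₁.eval x ^ 2 := by
      fun_prop
    have hpos : 0 < 4 * γ₁.eval s ^ 2 * α.derivative.eval s
      - 2 * γ₁.eval s * β₁.eval s * β.derivative.eval s + γ.derivative.eval s * β₁.eval s ^ 2 := by
      rw [hb, hg]
      rw [hg] at hs'
      nlinarith [mul_lt_mul_of_pos_left hlt hs']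
    filter_upwards [nhdsWithin_le_nhds (hcont.continuousAt.eventually (lt_mem_nhds hpos)),
      self_mem_nhdsWithin] with x hx hne
    have e1 : β.eval x = (x - s) * β₁.eval x := by rw [hβ₁]; simp
    have e2 : γ.eval x = (x - s) * γ₁.eval x := by rw [hγ₁]; simp
    rw [e1, e2]
    have : x - s ≠ 0 := sub_ne_zero.mpr hne
    have := mul_pos (by positivity : 0 < (x - s) ^ 2) hx
    linarith
  · have hcont : Continuous fun x ↦ 4 * γ.eval x ^ 2 * α.derivative.eval x
      - 2 * γ.eval x * β.eval x * β.derivative.eval x + γ.derivative.eval x * β.eval x ^ 2 := by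
      fun_prop
    refine nhdsWithin_le_nhds (hcont.continuousAt.eventually (lt_mem_nhds ?_))
    simp only [hs]
    simp
    positivity

/-- A pair has no component quadratic in `y` whose leading coefficient is a quadratic polynomial
with two distinct real roots. -/
lemma not_pos_of_two_roots (hJ : ∀ x y, 0 < jac F G x y) (hG : Supp G fun i j ↦ j ≤ 2)
    {k r s : ℝ} (hk : 0 < k) (hrs : r < s)
    (h2 : G 2 = Polynomial.C k * (Polynomial.X - Polynomial.C r) *
      (Polynomial.X - Polynomial.C s)) : False := by
  have hx := bi_dx_of_quadratic hG
  have hy := bi_dy_of_quadratic hG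
  have hd : ∀ x, (G 2).derivative.eval x = k * (x - s) + k * (x - r) := fun x ↦ by
    rw [h2]; simp
  have hv : ∀ x, (G 2).eval x = k * (x - r) * (x - s) := fun x ↦ by rw [h2]; simp
  have hne : ∀ x, (G 2).eval x = 0 → (G 1).eval x = 0 → ∀ y, (G 0).derivative.eval x
      + (G 1).derivative.eval x * y + (G 2).derivative.eval x * y ^ 2 ≠ 0 := by
    intro x e2 e1 y h0
    have := hJ x y
    rw [jac, hx, hy, h0, e1, e2] at this
    simp at this
  have hR : ∀ x, (G 2).eval x ≠ 0 → 4 * (G 2).eval x ^ 2 * (G 0).derivative.eval x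
      - 2 * (G 2).eval x * (G 1).eval x * (G 1).derivative.eval x
      + (G 2).derivative.eval x * (G 1).eval x ^ 2 ≠ 0 := by
    intro x e2 h0
    have := hJ x (-(G 1).eval x / (2 * (G 2).eval x))
    have e3 : (G 1).eval x + 2 * (G 2).eval x * (-(G 1).eval x / (2 * (G 2).eval x)) = 0 := by
      field_simp
      ring
    have e4 : (G 0).derivative.eval x + (G 1).derivative.eval x *
        (-(G 1).eval x / (2 * (G 2).eval x)) + (G 2).derivative.eval x *
        (-(G 1).eval x / (2 * (G 2).eval x)) ^ 2 = 0 := by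
      field_simp
      linear_combination h0
    rw [jac, hx, hy, e3, e4] at this
    simp at this
  have ps := eventually_resultant_pos (α := G 0) (β := G 1) (γ := G 2) (s := s)
    (by rw [hv]; ring) (by rw [hd]; nlinarith) (hne s (by rw [hv]; ring))
  have pr := eventually_resultant_pos (α := -G 0) (β := -G 1) (γ := -G 2) (s := r)
    (by simp [hv]) (by simp [hd]; nlinarith) (fun h0 y h ↦ hne r (by simp [hv])
      (by simpa using h0) y (by simp at h; linarith))
  obtain ⟨x₁, hx₁, hm₁⟩ := ((ps.filter_mono (nhdsWithin_mono s
    (show Set.Iio s ⊆ {s}ᶜ from fun x hx ↦ ne_of_lt hx))).and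
    (Ioo_mem_nhdsLT hrs)).exists
  obtain ⟨x₂, hx₂, hm₂⟩ := ((pr.filter_mono (nhdsWithin_mono r
    (show Set.Ioi r ⊆ {r}ᶜ from fun x hx ↦ ne_of_gt hx))).and
    (Ioo_mem_nhdsGT hrs)).exists
  simp only [Polynomial.eval_neg, Polynomial.derivative_neg] at hx₂
  have hcont : Continuous fun x ↦ 4 * (G 2).eval x ^ 2 * (G 0).derivative.eval x
      - 2 * (G 2).eval x * (G 1).eval x * (G 1).derivative.eval x
      + (G 2).derivative.eval x * (G 1).eval x ^ 2 := by fun_prop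
  obtain ⟨z, hz, h0⟩ := isPreconnected_Ioo.intermediate_value hm₂ hm₁ hcont.continuousOn
    (Set.mem_Icc.mpr ⟨by linarith, hx₁.le⟩)
  refine hR z ?_ h0
  rw [hv]
  exact mul_ne_zero (mul_ne_zero hk.ne' (sub_pos.mpr hz.1).ne') (sub_neg.mpr hz.2).ne

lemma bi_zero_left (y : ℝ) : bi F 0 y = ∑ j ∈ Finset.range 7, (F j).coeff 0 * y ^ j := by
  simp [bi, Polynomial.coeff_zero_eq_eval_zero]

lemma not_pos_of_cubic_aux (hJ : ∀ x y, 0 < jac F G x y)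
    (hF : Supp F fun i j ↦ j = 0 ∧ i ≤ 5 ∨ j = 1 ∧ i ≤ 3 ∨ j = 2 ∧ i ≤ 2 ∨ j = 3 ∧ i = 1)
    (hG : Supp G fun i j ↦ j = 0 ∧ i ≤ 6 ∨ j = 1 ∧ i ≤ 4 ∨ j = 2 ∧ i = 2)
    (ha : (F 3).coeff 1 ≠ 0) (hk : (G 2).coeff 2 ≠ 0) : False := by
  have hm : (G 1).coeff 0 = 0 := by
    have h := jac_lead_nonneg_of_finset hJ (hF.mono (by omega)) (hG.mono (by omega)) (-1) 1 2 1
      (S := {(1, 3), (0, 2)}) (T := {(0, 1)}) (by simp) (by simp)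
      (hF.mono (by simp; omega)) (hG.mono (by simp; omega))
    simp at h
    have h1 := h 1
    have h2 := h (-1)
    norm_num at h1 h2
    have : (F 3).coeff 1 * (G 1).coeff 0 = 0 := by linarith
    simpa [ha] using this
  have hG3 : ∀ j, 3 ≤ j → G j = 0 := fun j hj ↦ hG.eq_zero (by omega)
  have hF3 : ∀ j, 4 ≤ j → F j = 0 := fun j hj ↦ hF.eq_zero (by omega)
  have h03 : (F 3).coeff 0 = 0 := hF.coeff_eq_zero (by omega)
  have hg0 : (G 2).coeff 0 = 0 := hG.coeff_eq_zero (by omega)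
  have hg1 : (G 2).coeff 1 = 0 := hG.coeff_eq_zero (by omega)
  have hl : ∀ y, 0 < -(((F 1).coeff 0 + 2 * (F 2).coeff 0 * y) *
      ((G 0).coeff 1 + (G 1).coeff 1 * y)) := fun y ↦ by
    have := hJ 0 y
    simp only [jac, bi_zero_left, Finset.sum_range_succ, Finset.sum_range_zero, coeff_dx,
      coeff_dy] at this
    simp [hG3, hF3, h03, hg0, hg1, hm] at this
    norm_num at this
    linarith
  have he : (F 2).coeff 0 = 0 := by
    by_contra hne
    have := hl (-(F 1).coeff 0 / (2 * (F 2).coeff 0))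
    rw [mul_div_cancel₀ _ (by simpa using hne)] at this
    simp at this
  have hn : (G 1).coeff 1 = 0 := by
    by_contra hne
    have := hl (-(G 0).coeff 1 / (G 1).coeff 1)
    rw [mul_div_cancel₀ _ hne] at this
    simp at this
  have h0 := hl 0
  have hP : (F 1).coeff 0 * (G 2).coeff 2 = 0 := by
    replace hF := hF.erase he
    replace hG := (hG.erase hn).erase hm
    have h := jac_lead_nonneg_of_finset hJ (hF.mono (by omega)) (hG.mono (by omega)) (-2) 1 1 (-2)
      (S := {(1, 3), (0, 1)}) (T := {(1, 0), (2, 2)}) (by simp) (by simp)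
      (hF.mono (by simp; omega)) (hG.mono (by simp; omega))
    simp at h
    have := quadratic_nonneg (A := -((F 1).coeff 0 * (G 0).coeff 1))
      (B := -(2 * ((F 1).coeff 0 * (G 2).coeff 2) + 3 * ((F 3).coeff 1 * (G 0).coeff 1)))
      (C := -(4 * ((F 3).coeff 1 * (G 2).coeff 2))) fun z ↦ by
        have := h z 1
        norm_num at this
        linarith
    have e : ((F 1).coeff 0 * (G 2).coeff 2) ^ 2 = 0 := by
      nlinarith [sq_nonneg (((F 1).coeff 0 * (G 2).coeff 2) - 9 * ((F 3).coeff 1 * (G 0).coeff 1)),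
        sq_nonneg (((F 1).coeff 0 * (G 2).coeff 2) - 2 * ((F 3).coeff 1 * (G 0).coeff 1)),
        sq_nonneg (((F 1).coeff 0 * (G 2).coeff 2) - ((F 3).coeff 1 * (G 0).coeff 1)),
        sq_nonneg ((F 1).coeff 0 * (G 2).coeff 2), sq_nonneg ((F 3).coeff 1 * (G 0).coeff 1)]
    exact pow_eq_zero_iff two_ne_zero |>.mp e
  rcases mul_eq_zero.mp hP with h | h
  · simp [h, hn, he] at h0
  · exact hk h

lemma injective_of_cubic_aux (hJ : ∀ x y, 0 < jac F G x y)
    (hF : Supp F fun i j ↦ j = 0 ∧ i ≤ 5 ∨ j = 1 ∧ i ≤ 3 ∨ j = 2 ∧ i ≤ 2 ∨ j = 3 ∧ i = 1)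
    (hG : Supp G fun i j ↦ j = 0 ∧ i ≤ 6 ∨ j = 1 ∧ i ≤ 4 ∨ j = 2 ∧ i ≤ 2 ∨ j = 3 ∧ i = 0)
    (ha : (F 3).coeff 1 ≠ 0) (hB : 0 < (G 0).coeff 6) : Function.Injective (toMap F G) := by
  have ha' : 0 < (F 3).coeff 1 ^ 2 := by positivity
  have hw := jac_lead_nonneg_of_finset hJ (hF.mono (by omega)) (hG.mono (by omega)) 1 2 7 6
    (S := {(1, 3)}) (T := {(6, 0), (4, 1), (2, 2), (0, 3)}) (by simp) (by simp)
    (hF.mono (by simp; omega)) (hG.mono (by simp; omega))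
  simp at hw
  have hk0 : (G 3).coeff 0 = 0 := by
    have h1 := hw 0 1
    have h2 := hw 0 (-1)
    norm_num at h1 h2
    have : (F 3).coeff 1 * (G 3).coeff 0 = 0 := by linarith
    simpa [ha] using this
  have hk4 : 121 * (G 1).coeff 4 ^ 2 ≤ 288 * (G 0).coeff 6 * (G 2).coeff 2 := by
    have := quadratic_nonneg_of_sq_mul (A := -(18 * ((F 3).coeff 1 * (G 0).coeff 6)))
      (B := -(11 * ((F 3).coeff 1 * (G 1).coeff 4)))
      (C := -(4 * ((F 3).coeff 1 * (G 2).coeff 2))) fun z ↦ by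
        have := hw 1 z
        norm_num [hk0] at this
        linarith
    refine le_of_mul_le_mul_left ?_ ha'
    linarith
  have hk2 : 0 ≤ (G 2).coeff 2 := by
    by_contra! hneg
    nlinarith [mul_neg_of_pos_of_neg hB hneg, sq_nonneg ((G 1).coeff 4)]
  replace hG := hG.erase hk0
  have hl : (G 2).coeff 1 ^ 2 + 32 * (G 2).coeff 2 * (G 2).coeff 0 ≤ 0 := by
    have h := jac_lead_nonneg_of_finset hJ (hF.mono (by omega)) (hG.mono (by omega)) 0 1 3 2
      (S := {(1, 3)}) (T := {(2, 2), (1, 2), (0, 2)}) (by simp) (by simp)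
      (hF.mono (by simp; omega)) (hG.mono (by simp; omega))
    simp at h
    have := quadratic_nonneg (A := 2 * ((F 3).coeff 1 * (G 2).coeff 0))
      (B := -((F 3).coeff 1 * (G 2).coeff 1))
      (C := -(4 * ((F 3).coeff 1 * (G 2).coeff 2))) fun z ↦ by
        have := h z 1
        norm_num at this
        linarith
    refine le_of_mul_le_mul_left ?_ ha'
    linarith
  have hG2 : G 2 = Polynomial.C ((G 2).coeff 2) * Polynomial.X ^ 2
      + Polynomial.C ((G 2).coeff 1) * Polynomial.X + Polynomial.C ((G 2).coeff 0) :=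
    Polynomial.eq_quadratic_of_degree_le_two
      (Polynomial.degree_le_of_natDegree_le (n := 2) (hG.natDegree_le (by omega)))
  rcases hk2.eq_or_lt with hk2 | hk2
  · have hk4' : (G 1).coeff 4 = 0 := by
      rw [← hk2] at hk4
      exact pow_eq_zero_iff two_ne_zero |>.mp (le_antisymm (by linarith) (sq_nonneg _))
    have hl1 : (G 2).coeff 1 = 0 := by
      rw [← hk2] at hl
      exact pow_eq_zero_iff two_ne_zero |>.mp (le_antisymm (by linarith) (sq_nonneg _))
    replace hG := ((hG.erase hk4').erase hk2.symm).erase hl1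
    refine injective_of_comb 0 1 (-1) 0 ?_
    have hJ' : ∀ x y, 0 < jac (comb 0 1 F G) (comb (-1) 0 F G) x y := fun x y ↦ by
      rw [jac_comb]; simpa using hJ x y
    by_cases hl0 : (G 2).coeff 0 = 0
    · exact injective_of_affine hJ' ((hF.comb (hG.erase hl0) 0 1).mono (by simp; omega))
        ((hF.comb hG (-1) 0).mono (by simp; omega))
    · refine injective_of_quadratic hJ' ((hF.comb hG 0 1).mono (by simp; omega))
        ((hF.comb hG (-1) 0).mono (by simp; omega)) hl0 ?_
      rw [hl1, ← hk2] at hG2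
      simpa [comb] using hG2
  · exfalso
    have hl0 : (G 2).coeff 0 ≤ 0 := by
      by_contra! hpos
      nlinarith [mul_pos hk2 hpos, sq_nonneg ((G 2).coeff 1)]
    rcases hl0.eq_or_lt with hl0 | hl0
    · have hl1 : (G 2).coeff 1 = 0 := by
        rw [hl0] at hl
        exact pow_eq_zero_iff two_ne_zero |>.mp (le_antisymm (by linarith) (sq_nonneg _))
      exact not_pos_of_cubic_aux hJ hF (((hG.erase hl0).erase hl1).mono (by omega)) ha hk2.ne'
    · set k := (G 2).coeff 2
      set l := (G 2).coeff 1
      set m := (G 2).coeff 0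
      have hdisc : 0 < l ^ 2 - 4 * k * m := by
        nlinarith [mul_neg_of_pos_of_neg hk2 hl0, sq_nonneg l]
      have hsq := Real.sq_sqrt hdisc.le
      have hpos := Real.sqrt_pos.mpr hdisc
      set w := √(l ^ 2 - 4 * k * m)
      refine not_pos_of_two_roots hJ (hG.mono (by omega)) hk2
        (r := (-l - w) / (2 * k)) (s := (-l + w) / (2 * k)) (by gcongr; linarith) ?_
      have e1 : l = -(k * ((-l - w) / (2 * k)) + k * ((-l + w) / (2 * k))) := by
        field_simp
        ring
      have e2 : m = k * ((-l - w) / (2 * k)) * ((-l + w) / (2 * k)) := by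
        field_simp
        linear_combination hsq
      rw [hG2]
      conv_lhs => rw [e1, e2]
      simp only [Polynomial.C_neg, Polynomial.C_add, Polynomial.C_mul]
      ring

/-- Injectivity when `f` is cubic in `y` with leading coefficient of degree one. -/
theorem injective_of_cubic (hJ : ∀ x y, 0 < jac F G x y)
    (hF : Supp F fun i j ↦ j = 0 ∧ i ≤ 5 ∨ j = 1 ∧ i ≤ 3 ∨ j = 2 ∧ i ≤ 2 ∨ j = 3 ∧ i ≤ 1)
    (hG : Supp G fun i j ↦ j = 0 ∧ i ≤ 6 ∨ j = 1 ∧ i ≤ 4 ∨ j = 2 ∧ i ≤ 2 ∨ j = 3 ∧ i ≤ 1)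
    (ha : (F 3).coeff 1 ≠ 0) (hB : (G 0).coeff 6 ≠ 0) : Function.Injective (toMap F G) := by
  obtain ⟨ε, hε, hεB⟩ : ∃ ε : ℝ, ε * ε = 1 ∧ 0 < ε * (G 0).coeff 6 := by
    rcases hB.lt_or_gt with h | h
    · exact ⟨-1, by norm_num, by linarith⟩
    · exact ⟨1, by norm_num, by linarith⟩
  have hε0 : ε ≠ 0 := fun h ↦ by simp [h] at hε
  set s := -(F 3).coeff 0 / (F 3).coeff 1
  refine injective_of_shift s ?_
  have hF' : Supp (shift s F) _ := hF.shift s (by omega)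
  have hG' : Supp (shift s G) _ := hG.shift s (by omega)
  have hJ' : ∀ x y, 0 < jac (shift s F) (shift s G) x y := fun x y ↦ by
    rw [jac_shift]; exact hJ _ _
  have c31 : (shift s F 3).coeff 1 = (F 3).coeff 1 :=
    coeff_shift_of_natDegree_le s (hF.natDegree_le (by omega))
  have c60 : (shift s G 0).coeff 6 = (G 0).coeff 6 :=
    coeff_shift_of_natDegree_le s (hG.natDegree_le (by omega))
  have c06 : (shift s F 0).coeff 6 = 0 := hF'.coeff_eq_zero (by omega)
  have c30 : (shift s F 3).coeff 0 = 0 := by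
    rw [shift, Polynomial.taylor_coeff_zero,
      Polynomial.eq_X_add_C_of_natDegree_le_one (p := F 3) (hF.natDegree_le (by omega))]
    simp [s, mul_div_cancel₀ _ ha]
  set F' := shift s F
  set G' := shift s G
  set t := -(ε * (G' 3).coeff 1 / (F' 3).coeff 1) with ht
  rw [← c31] at ha
  rw [← c60] at hεB
  have e31 : (comb t ε F' G' 3).coeff 1 = 0 := by
    rw [coeff_comb, ht]
    field_simp
    ring
  refine injective_of_comb ε 0 t ε (injective_of_cubic_aux ?_ ?_ ?_ ?_ ?_)
  · intro x y
    rw [jac_comb, hε]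
    simpa using hJ' x y
  · exact (((hF'.erase c30).comb hG' ε 0).mono (by simp; omega))
  · exact (((hF'.comb hG' t ε).erase e31).mono (by omega))
  · simp [coeff_comb, hε0, ha]
  · simpa [coeff_comb, c06]

lemma nonneg_of_pow_mul {q : ℝ → ℝ} (hq : Continuous q) {n : ℕ} (h : ∀ z, 0 ≤ z ^ n * q z) :
    0 ≤ q 0 :=
  ge_of_tendsto (hq.continuousAt.tendsto.mono_left (nhdsWithin_le_nhds (s := Set.Ioi 0)))
    (eventually_nhdsWithin_of_forall fun z hz ↦
      nonneg_of_mul_nonneg_right (h z) (pow_pos hz n))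

lemma eq_zero_of_odd_pow_mul {q : ℝ → ℝ} (hq : Continuous q) {n : ℕ} (hn : Odd n)
    (h : ∀ z, 0 ≤ z ^ n * q z) : q 0 = 0 := by
  refine le_antisymm ?_ (nonneg_of_pow_mul hq h)
  have := nonneg_of_pow_mul (q := fun z ↦ -q (-z)) (by fun_prop) (n := n) fun z ↦ by
    have := h (-z)
    rw [hn.neg_pow] at this
    linarith
  simpa using this

set_option maxHeartbeats 1000000 in
/-- Injectivity when both top forms are powers of `x`, of degrees five and six. -/
theorem injective_of_top_pow (hJ : ∀ x y, 0 < jac F G x y)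
    (hF : Supp F fun i j ↦ i + j ≤ 4 ∨ i = 5 ∧ j = 0)
    (hG : Supp G fun i j ↦ i + j ≤ 5 ∨ i = 6 ∧ j = 0)
    (hA : (F 0).coeff 5 ≠ 0) (hB : (G 0).coeff 6 ≠ 0) : Function.Injective (toMap F G) := by
  by_cases h05 : (G 5).coeff 0 = 0
  swap
  · refine injective_of_lead (hF.mono (by omega)) (hG.mono (by omega)) hJ (p := 5) (q := 6)
      (d := 25) (e := 30) (by norm_num) (by norm_num) (by norm_num) (by norm_num)
      (hF.mono (by omega)) (hG.mono (by omega)) fun x y h1 h2 ↦ ?_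
    simp [lead, Finset.sum_range_succ] at h1 h2
    have hx : x = 0 := by simpa [hA] using h1
    subst hx
    simpa [h05] using h2
  replace hG := hG.erase h05
  obtain ⟨h04, h14⟩ : (F 4).coeff 0 = 0 ∧ (G 4).coeff 1 = 0 := by
    have h := jac_lead_nonneg_of_finset hJ (hF.mono (by omega)) (hG.mono (by omega)) 4 5 20 24
      (S := {(5, 0), (0, 4)}) (T := {(6, 0), (1, 4)}) (by simp) (by simp)
      (hF.mono (by simp; omega)) (hG.mono (by simp; omega))
    simp at h
    have h1 := h 0 1
    have h2 := h 0 (-1)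
    have h3 := h 1 1
    have h4 := h (-1) 1
    norm_num at h1 h2 h3 h4
    have e1 : (F 4).coeff 0 * (G 4).coeff 1 = 0 := by linarith
    have e2 : 5 * ((F 0).coeff 5 * (G 4).coeff 1) = 6 * ((G 0).coeff 6 * (F 4).coeff 0) := by
      linarith
    rcases mul_eq_zero.mp e1 with e | e
    · exact ⟨e, by simpa [e, hA] using e2⟩
    · exact ⟨by simpa [e, hB] using e2, e⟩
  replace hF := hF.erase h04
  replace hG := hG.erase h14
  have h1323 : (F 3).coeff 1 * (G 3).coeff 2 = 0 := by
    have h := jac_lead_nonneg_of_finset hJ (hF.mono (by omega)) (hG.mono (by omega)) 3 4 15 18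
      (S := {(5, 0), (1, 3)}) (T := {(6, 0), (2, 3)}) (by simp) (by simp)
      (hF.mono (by simp; omega)) (hG.mono (by simp; omega))
    simp at h
    have h1 := nonneg_of_pow_mul (n := 2) (q := fun z ↦ (15 * ((F 0).coeff 5 * (G 3).coeff 2)
      - 18 * ((F 3).coeff 1 * (G 0).coeff 6)) * z ^ 4 - 3 * ((F 3).coeff 1 * (G 3).coeff 2))
      (by fun_prop) fun z ↦ by
        have := h z 1
        norm_num at this
        linarith
    have h2 := nonneg_of_pow_mul (n := 2) (q := fun z ↦ (15 * ((F 0).coeff 5 * (G 3).coeff 2)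
      - 18 * ((F 3).coeff 1 * (G 0).coeff 6)) * z ^ 4 + 3 * ((F 3).coeff 1 * (G 3).coeff 2))
      (by fun_prop) fun z ↦ by
        have := h z (-1)
        norm_num at this
        linarith
    norm_num at h1 h2
    linarith
  by_cases h13 : (F 3).coeff 1 = 0
  swap
  · have h23 : (G 3).coeff 2 = 0 := by simpa [h13] using h1323
    replace hG := hG.erase h23
    by_cases hg04 : (G 4).coeff 0 = 0
    swap
    · refine injective_of_lead (hF.mono (by omega)) (hG.mono (by omega)) hJ (p := 2) (q := 3)
        (d := 11) (e := 12) (by norm_num) (by norm_num) (by norm_num) (by norm_num)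
        (hF.mono (by omega)) (hG.mono (by omega)) fun x y h1 h2 ↦ ?_
      have h41 : (F 1).coeff 4 = 0 := hF.coeff_eq_zero (by omega)
      simp [lead, Finset.sum_range_succ, h41] at h1 h2
      rcases h1 with h1 | rfl | rfl
      · exact absurd h1 h13
      · simpa [hg04] using h2
      · simpa [hB] using h2
    replace hG := hG.erase hg04
    have h32 : (G 2).coeff 3 = 0 := by
      have h := jac_lead_nonneg_of_finset hJ (hF.mono (by omega)) (hG.mono (by omega)) 2 3 11 12
        (S := {(1, 3)}) (T := {(6, 0), (3, 2)}) (by simp) (by simp)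
        (hF.mono (by simp; omega)) (hG.mono (by simp; omega))
      simp at h
      have := eq_zero_of_odd_pow_mul (n := 3) (q := fun z ↦
        -(18 * ((F 3).coeff 1 * (G 0).coeff 6)) * z ^ 3 - 7 * ((F 3).coeff 1 * (G 2).coeff 3))
        (by fun_prop) (by decide) fun z ↦ by
          have := h z 1
          norm_num at this
          linarith
      simpa [h13] using this
    exact injective_of_cubic hJ (hF.mono (by omega)) ((hG.erase h32).mono (by omega)) h13 hB
  replace hF := hF.erase h13
  obtain ⟨h22, h03⟩ : (F 2).coeff 2 = 0 ∧ (F 3).coeff 0 = 0 := by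
    by_cases h23 : (G 3).coeff 2 = 0
    · replace hG := hG.erase h23
      obtain ⟨h22, h32, hg04⟩ :
          (F 2).coeff 2 = 0 ∧ (G 2).coeff 3 = 0 ∧ (G 4).coeff 0 = 0 := by
        have h := jac_lead_nonneg_of_finset hJ (hF.mono (by omega)) (hG.mono (by omega)) 2 3 10 12
          (S := {(5, 0), (2, 2)}) (T := {(6, 0), (3, 2), (0, 4)}) (by simp) (by simp)
          (hF.mono (by simp; omega)) (hG.mono (by simp; omega))
        simp at h
        have h1 := h 1 1
        have h2 := h 1 (-1)
        have h3 := h 1 2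
        have h4 := h 1 (-2)
        have h5 := h 1 3
        have h6 := h 1 (-3)
        norm_num at h1 h2 h3 h4 h5 h6
        have e1 : (F 2).coeff 2 * (G 4).coeff 0 = 0 := by linarith
        have e2 : 5 * ((F 0).coeff 5 * (G 2).coeff 3) = 6 * ((F 2).coeff 2 * (G 0).coeff 6) := by
          linarith
        have e3 : 10 * ((F 0).coeff 5 * (G 4).coeff 0) = (F 2).coeff 2 * (G 2).coeff 3 := by
          linarith
        have e4 : (F 2).coeff 2 = 0 := by
          rcases mul_eq_zero.mp e1 with e | e
          · exact e
          · rcases mul_eq_zero.mp (show (F 2).coeff 2 * (G 2).coeff 3 = 0 by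
              rw [← e3, e]; ring) with e' | e'
            · exact e'
            · simpa [e', hB] using e2
        exact ⟨e4, by simpa [e4, hA] using e2, by simpa [e4, hA] using e3⟩
      refine ⟨h22, ?_⟩
      replace hF := hF.erase h22
      replace hG := (hG.erase h32).erase hg04
      have h := jac_lead_nonneg_of_finset hJ (hF.mono (by omega)) (hG.mono (by omega)) 3 5 15 18
        (S := {(5, 0), (0, 3)}) (T := {(6, 0), (1, 3)}) (by simp) (by simp)
        (hF.mono (by simp; omega)) (hG.mono (by simp; omega))
      simp at h
      have h1 := h 0 1
      have h2 := h 0 (-1)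
      have h3 := h 1 1
      have h4 := h (-1) (-1)
      have h5 := h 1 (-1)
      have h6 := h (-1) 1
      norm_num at h1 h2 h3 h4 h5 h6
      have e1 : (F 3).coeff 0 * (G 3).coeff 1 = 0 := by linarith
      have e2 : 5 * ((F 0).coeff 5 * (G 3).coeff 1) = 6 * ((F 3).coeff 0 * (G 0).coeff 6) := by
        linarith
      rcases mul_eq_zero.mp e1 with e | e
      · exact e
      · simpa [e, hB] using e2
    · have h22 : (F 2).coeff 2 = 0 := by
        have h := jac_lead_nonneg_of_finset hJ (hF.mono (by omega)) (hG.mono (by omega)) 2 3 10 13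
          (S := {(5, 0), (2, 2)}) (T := {(2, 3)}) (by simp) (by simp)
          (hF.mono (by simp; omega)) (hG.mono (by simp; omega))
        simp at h
        have := eq_zero_of_odd_pow_mul (n := 3) (q := fun z ↦
          15 * ((F 0).coeff 5 * (G 3).coeff 2) * z ^ 3 + 2 * ((F 2).coeff 2 * (G 3).coeff 2))
          (by fun_prop) (by decide) fun z ↦ by
            have := h z 1
            norm_num at this
            linarith
        simpa [h23] using this
      refine ⟨h22, ?_⟩
      replace hF := hF.erase h22
      have h := jac_lead_nonneg_of_finset hJ (hF.mono (by omega)) (hG.mono (by omega)) 3 5 15 21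
        (S := {(5, 0), (0, 3)}) (T := {(2, 3)}) (by simp) (by simp)
        (hF.mono (by simp; omega)) (hG.mono (by simp; omega))
      simp at h
      have := eq_zero_of_odd_pow_mul (n := 1) (q := fun z ↦
        15 * ((F 0).coeff 5 * (G 3).coeff 2) * z ^ 5 - 6 * ((F 3).coeff 0 * (G 3).coeff 2))
        (by fun_prop) (by decide) fun z ↦ by
          have := h z 1
          norm_num at this
          linarith
      simpa [h23] using this
  exact injective_of_degree_two hJ (((hF.erase h22).erase h03).mono (by omega))
    (hG.mono (by omega)) hA

/-- The coefficients of a polynomial in two variables with respect to the second one. -/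
noncomputable def array (f : MvPolynomial (Fin 2) ℝ) (j : ℕ) : ℝ[X] :=
  ∑ d ∈ f.support with d 1 = j, Polynomial.monomial (d 0) (f.coeff d)

lemma coeff_array (f : MvPolynomial (Fin 2) ℝ) (i j : ℕ) :
    (array f j).coeff i = f.coeff (Finsupp.single 0 i + Finsupp.single 1 j) := by
  rw [array, Polynomial.finsetSum_coeff]
  have key : ∀ d : Fin 2 →₀ ℕ, d 1 = j → d 0 = i →
      d = Finsupp.single 0 i + Finsupp.single 1 j := by
    rintro d rfl rfl
    ext k
    fin_cases k <;> simp
  rw [Finset.sum_eq_single (Finsupp.single 0 i + Finsupp.single 1 j)]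
  · simp
  · intro d hd hne
    rw [Polynomial.coeff_monomial, if_neg fun h ↦ hne (key d (Finset.mem_filter.mp hd).2 h)]
  · intro h
    simp at h
    simp [h]

lemma array_pderiv_zero (f : MvPolynomial (Fin 2) ℝ) : array (pderiv 0 f) = dx (array f) := by
  ext j i
  rw [coeff_dx, coeff_array, coeff_array, coeff_pderiv]
  have : (Finsupp.single 0 i + Finsupp.single 1 j + Finsupp.single 0 1 : Fin 2 →₀ ℕ) =
      Finsupp.single 0 (i + 1) + Finsupp.single 1 j := by
    rw [Finsupp.single_add]; abel
  rw [this]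
  simp

lemma array_pderiv_one (f : MvPolynomial (Fin 2) ℝ) : array (pderiv 1 f) = dy (array f) := by
  ext j i
  rw [coeff_dy, coeff_array, coeff_array, coeff_pderiv]
  have : (Finsupp.single 0 i + Finsupp.single 1 j + Finsupp.single 1 1 : Fin 2 →₀ ℕ) =
      Finsupp.single 0 i + Finsupp.single 1 (j + 1) := by
    rw [Finsupp.single_add]; abel
  rw [this]
  simp [mul_comm]

lemma supp_array {f : MvPolynomial (Fin 2) ℝ} {n : ℕ} (hf : f.totalDegree ≤ n) :
    Supp (array f) fun i j ↦ i + j ≤ n := by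
  intro i j h
  rw [coeff_array, ← mem_support_iff] at h
  have := le_totalDegree h
  rw [Finsupp.sum_fintype _ _ fun _ ↦ rfl] at this
  simp at this
  omega

lemma bi_array {f : MvPolynomial (Fin 2) ℝ} (hf : Supp (array f) fun _ j ↦ j ≤ 6) (x y : ℝ) :
    bi (array f) x y = eval ![x, y] f := by
  have hmem : ∀ d ∈ f.support, d 1 ∈ Finset.range 7 := fun d hd ↦ by
    have := hf (d 0) (d 1)
    rw [coeff_array] at this
    have e : Finsupp.single 0 (d 0) + Finsupp.single 1 (d 1) = d := by
      ext k
      fin_cases k <;> simp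
    rw [e] at this
    have := this (mem_support_iff.mp hd)
    simp
    omega
  rw [eval_eq', ← Finset.sum_fiberwise_of_maps_to hmem, bi]
  refine Finset.sum_congr rfl fun j _ ↦ ?_
  rw [array, Polynomial.eval_finsetSum, Finset.sum_mul]
  refine Finset.sum_congr rfl fun d hd ↦ ?_
  rw [Polynomial.eval_monomial, Fin.prod_univ_two, ← (Finset.mem_filter.mp hd).2]
  simp [mul_assoc]

lemma jac_array {f g : MvPolynomial (Fin 2) ℝ} (hf : f.totalDegree ≤ 6) (hg : g.totalDegree ≤ 6)
    (x y : ℝ) : jac (array f) (array g) x y = eval ![x, y] (Jac f g) := by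
  have hf' := supp_array hf
  have hg' := supp_array hg
  have h1 : Supp (array (pderiv 0 f)) fun _ j ↦ j ≤ 6 := by
    rw [array_pderiv_zero]
    exact hf'.dx.mono (by omega)
  have h2 : Supp (array (pderiv 1 f)) fun _ j ↦ j ≤ 6 := by
    rw [array_pderiv_one]
    exact hf'.dy.mono (by omega)
  have h3 : Supp (array (pderiv 0 g)) fun _ j ↦ j ≤ 6 := by
    rw [array_pderiv_zero]
    exact hg'.dx.mono (by omega)
  have h4 : Supp (array (pderiv 1 g)) fun _ j ↦ j ≤ 6 := by
    rw [array_pderiv_one]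
    exact hg'.dy.mono (by omega)
  rw [jac, ← array_pderiv_zero, ← array_pderiv_zero, ← array_pderiv_one, ← array_pderiv_one,
    bi_array h1, bi_array h2, bi_array h3, bi_array h4]
  simp [Jac]

/-- Linear substitution in a polynomial in two variables. -/
noncomputable def linSubst (a b c d : ℝ) : MvPolynomial (Fin 2) ℝ →ₐ[ℝ] MvPolynomial (Fin 2) ℝ :=
  bind₁ ![C a * X 0 + C b * X 1, C c * X 0 + C d * X 1]

lemma eval_linSubst (a b c d x y : ℝ) (f : MvPolynomial (Fin 2) ℝ) :
    eval ![x, y] (linSubst a b c d f) = eval ![a * x + b * y, c * x + d * y] f := by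
  rw [linSubst, ← coe_aeval_eq_eval, ← coe_aeval_eq_eval]
  change aeval _ (bind₁ _ f) = aeval _ f
  rw [aeval_bind₁]
  congr 2
  funext k
  fin_cases k <;> simp

lemma totalDegree_linSubst_le (a b c d : ℝ) (f : MvPolynomial (Fin 2) ℝ) :
    (linSubst a b c d f).totalDegree ≤ f.totalDegree := by
  have hlin : ∀ a b : ℝ, (C a * X 0 + C b * X 1 : MvPolynomial (Fin 2) ℝ).totalDegree ≤ 1 :=
    fun a b ↦ by
      refine (totalDegree_add _ _).trans (max_le ?_ ?_) <;>
      · refine (totalDegree_mul _ _).trans ?_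
        simp
  have h1 : linSubst a b c d f = ∑ e ∈ f.support, C (f.coeff e) *
      ((C a * X 0 + C b * X 1) ^ e 0 * (C c * X 0 + C d * X 1) ^ e 1) := by
    conv_lhs => rw [linSubst, f.as_sum, map_sum]
    refine Finset.sum_congr rfl fun e _ ↦ ?_
    rw [bind₁_monomial]
    congr 1
    rw [Finset.prod_subset (Finset.subset_univ _) fun k _ hk ↦ by
      simp [Finsupp.notMem_support_iff.mp hk]]
    simp [Fin.prod_univ_two]
  rw [h1]
  refine totalDegree_finsetSum_le fun e he ↦ ?_
  have hdeg := le_totalDegree he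
  rw [Finsupp.sum_fintype _ _ fun _ ↦ rfl, Fin.sum_univ_two] at hdeg
  refine ((totalDegree_mul _ _).trans (add_le_add le_rfl (totalDegree_mul _ _))).trans ?_
  have e1 := (totalDegree_pow (C a * X 0 + C b * X 1 : MvPolynomial (Fin 2) ℝ) (e 0)).trans
    (Nat.mul_le_mul_left _ (hlin a b))
  have e2 := (totalDegree_pow (C c * X 0 + C d * X 1 : MvPolynomial (Fin 2) ℝ) (e 1)).trans
    (Nat.mul_le_mul_left _ (hlin c d))
  rw [totalDegree_C]
  omega

lemma totalDegree_linSubst {a b c d : ℝ} (h : a * d - b * c = 1) (f : MvPolynomial (Fin 2) ℝ) :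
    (linSubst a b c d f).totalDegree = f.totalDegree := by
  refine le_antisymm (totalDegree_linSubst_le _ _ _ _ f) ?_
  have : linSubst d (-b) (-c) a (linSubst a b c d f) = f := by
    refine MvPolynomial.funext fun p ↦ ?_
    have hp : p = ![p 0, p 1] := by ext k; fin_cases k <;> rfl
    rw [hp, eval_linSubst, eval_linSubst]
    congr 2
    ext k
    fin_cases k
    · simp
      linear_combination p 0 * h
    · simp
      linear_combination p 1 * h
  conv_lhs => rw [← this]
  exact totalDegree_linSubst_le _ _ _ _ _

lemma bi_partial_comp {F H : ℕ → ℝ[X]} (hF : Supp F fun i j ↦ i + j ≤ 6)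
    (hH : Supp H fun i j ↦ i + j ≤ 6) {a b c d : ℝ}
    (h : ∀ x y, bi H x y = bi F (a * x + b * y) (c * x + d * y)) (x y : ℝ) :
    bi (dx H) x y = a * bi (dx F) (a * x + b * y) (c * x + d * y)
      + c * bi (dy F) (a * x + b * y) (c * x + d * y) ∧
    bi (dy H) x y = b * bi (dx F) (a * x + b * y) (c * x + d * y)
      + d * bi (dy F) (a * x + b * y) (c * x + d * y) := by
  have h1 : HasFDerivAt (fun P : ℝ × ℝ ↦ P.1) (ContinuousLinearMap.fst ℝ ℝ ℝ) (x, y) :=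
    hasFDerivAt_fst
  have h2 : HasFDerivAt (fun P : ℝ × ℝ ↦ P.2) (ContinuousLinearMap.snd ℝ ℝ ℝ) (x, y) :=
    hasFDerivAt_snd
  have h3 := ((h1.const_mul a).add (h2.const_mul b)).prodMk
    ((h1.const_mul c).add (h2.const_mul d))
  have h4 := (hasStrictFDerivAt_bi hF (a * x + b * y, c * x + d * y)).hasFDerivAt
  have h5 := HasFDerivAt.comp (x, y) h4 h3
  have h6 := (hasStrictFDerivAt_bi hH (x, y)).hasFDerivAt
  have h7 : (fun P : ℝ × ℝ ↦ bi H P.1 P.2) = (fun P : ℝ × ℝ ↦ bi F P.1 P.2) ∘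
      fun P : ℝ × ℝ ↦ (a * P.1 + b * P.2, c * P.1 + d * P.2) := by
    funext P
    exact h _ _
  rw [h7] at h6
  have h8 := h6.unique h5
  constructor
  · have := congrArg (fun T : ℝ × ℝ →L[ℝ] ℝ ↦ T (1, 0)) h8
    simp at this
    linarith
  · have := congrArg (fun T : ℝ × ℝ →L[ℝ] ℝ ↦ T (0, 1)) h8
    simp at this
    linarith

lemma lead_comp {F H : ℕ → ℝ[X]} {n : ℕ} (hn : n ≤ 6) (hF : Supp F fun i j ↦ i + j ≤ n)
    (hH : Supp H fun i j ↦ i + j ≤ n) {a b c d : ℝ}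
    (h : ∀ x y, bi H x y = bi F (a * x + b * y) (c * x + d * y)) (x y : ℝ) :
    lead H 1 1 n x y = lead F 1 1 n (a * x + b * y) (c * x + d * y) := by
  have h1 := tendsto_lead (hH.mono (by omega)) (p := 1) (q := 1) (d := n) (hH.mono (by omega)) x y
  have h2 := tendsto_lead (hF.mono (by omega)) (p := 1) (q := 1) (d := n) (hF.mono (by omega))
    (a * x + b * y) (c * x + d * y)
  refine tendsto_nhds_unique h1 (h2.congr fun t ↦ ?_)
  rw [h]
  congr 2 <;> ring

lemma exists_eq_X_pow_mul {P : ℝ[X]} (hP : P ≠ 0) :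
    ∃ (m : ℕ) (R : ℝ[X]), P = Polynomial.X ^ m * R ∧ R.eval 0 ≠ 0 := by
  obtain ⟨R, hR, hd⟩ := P.exists_eq_pow_rootMultiplicity_mul_and_not_dvd hP 0
  rw [Polynomial.dvd_iff_isRoot] at hd
  exact ⟨_, R, by simpa using hR, hd⟩

lemma orders_of_log_derivative {P Q : ℝ[X]} {p q m k : ℕ} {R S : ℝ[X]}
    (hP : P = Polynomial.X ^ m * R) (hQ : Q = Polynomial.X ^ k * S) (hR : R.eval 0 ≠ 0)
    (hS : S.eval 0 ≠ 0)
    (h : (q : ℝ[X]) * P.derivative * Q = (p : ℝ[X]) * P * Q.derivative) : q * m = p * k := by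
  have hX : ∀ (n : ℕ) (T : ℝ[X]), Polynomial.X * (Polynomial.X ^ n * T).derivative =
      Polynomial.X ^ n * ((n : ℝ[X]) * T + Polynomial.X * T.derivative) := by
    intro n T
    rcases n with _ | n
    · simp
    · simp only [Polynomial.derivative_mul, Polynomial.derivative_X_pow, map_natCast]
      push_cast
      ring
  have h1 : Polynomial.X ^ (m + k) * ((q : ℝ[X]) * ((m : ℝ[X]) * R + Polynomial.X * R.derivative)
      * S - (p : ℝ[X]) * R * ((k : ℝ[X]) * S + Polynomial.X * S.derivative)) = 0 := by
    have hm := hX m R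
    have hk := hX k S
    rw [← hP] at hm
    rw [← hQ] at hk
    linear_combination Polynomial.X * h - (q : ℝ[X]) * Q * hm + (p : ℝ[X]) * P * hk
      - (q : ℝ[X]) * Polynomial.X ^ m * ((m : ℝ[X]) * R + Polynomial.X * R.derivative) * hQ
      + (p : ℝ[X]) * Polynomial.X ^ k * ((k : ℝ[X]) * S + Polynomial.X * S.derivative) * hP
  have h2 := (mul_eq_zero.mp h1).resolve_left (pow_ne_zero _ Polynomial.X_ne_zero)
  have h3 := congrArg (Polynomial.eval 0) h2
  simp at h3
  have h4 : ((q : ℝ) * m - p * k) * (R.eval 0 * S.eval 0) = 0 := by linarith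
  have h5 := (mul_eq_zero.mp h4).resolve_right (mul_ne_zero hR hS)
  exact_mod_cast sub_eq_zero.mp h5

lemma coeff_of_order {P R : ℝ[X]} {m : ℕ} (hP : P = Polynomial.X ^ m * R) (hR : R.eval 0 ≠ 0) :
    P.coeff m ≠ 0 ∧ ∀ i < m, P.coeff i = 0 := by
  rw [hP]
  refine ⟨?_, fun i hi ↦ ?_⟩
  · simpa [Polynomial.coeff_X_pow_mul', Polynomial.coeff_zero_eq_eval_zero] using hR
  · rw [Polynomial.coeff_X_pow_mul', if_neg (by omega)]

/-- The dehomogenised form of degree `n`. -/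
noncomputable def topForm (F : ℕ → ℝ[X]) (n : ℕ) : ℝ[X] :=
  ∑ i ∈ Finset.range (n + 1), Polynomial.monomial i ((F (n - i)).coeff i)

lemma coeff_topForm {n i : ℕ} (hi : i ≤ n) : (topForm F n).coeff i = (F (n - i)).coeff i := by
  simp only [topForm, Polynomial.finsetSum_coeff, Polynomial.coeff_monomial]
  rw [Finset.sum_ite_eq_of_mem' _ _ _ (by simp; omega)]

lemma coeff_topForm_eq_zero {n i : ℕ} (hi : n < i) : (topForm F n).coeff i = 0 := by
  simp only [topForm, Polynomial.finsetSum_coeff, Polynomial.coeff_monomial]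
  refine Finset.sum_eq_zero fun j hj ↦ if_neg ?_
  simp at hj
  omega

set_option maxHeartbeats 1000000 in
/-- The top forms have vanishing Jacobian. -/
lemma topForm_derivative (hJ : ∀ x y, 0 < jac F G x y) (hF : Supp F fun i j ↦ i + j ≤ 5)
    (hG : Supp G fun i j ↦ i + j ≤ 6) :
    (6 : ℕ) * (topForm F 5).derivative * topForm G 6
      = (5 : ℕ) * topForm F 5 * (topForm G 6).derivative := by
  have h := jac_lead_nonneg hJ (hF.mono (by omega)) hG 1 1 5 6 (hF.mono (by omega))
    (hG.mono (by omega))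
  refine Polynomial.funext fun x ↦ ?_
  have h1 := h x 1
  have h2 := h (-x) (-1)
  simp [lead, Finset.sum_range_succ, coeff_dx, coeff_dy] at h1 h2
  simp [topForm, Finset.sum_range_succ]
  norm_num at h1 h2 ⊢
  linarith

lemma injective_of_top (hJ : ∀ x y, 0 < jac F G x y) (hF : Supp F fun i j ↦ i + j ≤ 5)
    (hG : Supp G fun i j ↦ i + j ≤ 6) (h0 : (F 5).coeff 0 = 0)
    (hF0 : ∃ i j, i + j = 5 ∧ (F j).coeff i ≠ 0) (hG0 : ∃ i j, i + j = 6 ∧ (G j).coeff i ≠ 0) :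
    Function.Injective (toMap F G) := by
  have hne : ∀ {H : ℕ → ℝ[X]} {n : ℕ}, (∃ i j, i + j = n ∧ (H j).coeff i ≠ 0) →
      topForm H n ≠ 0 := by
    rintro H n ⟨i, j, rfl, hij⟩ hc
    have := coeff_topForm (F := H) (show i ≤ i + j by omega)
    rw [hc, Nat.add_sub_cancel_left] at this
    exact hij this.symm
  obtain ⟨m, R, hP, hR⟩ := exists_eq_X_pow_mul (hne hF0)
  obtain ⟨k, S, hQ, hS⟩ := exists_eq_X_pow_mul (hne hG0)
  have horder := orders_of_log_derivative hP hQ hR hS (topForm_derivative hJ hF hG)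
  obtain ⟨hm, hm'⟩ := coeff_of_order hP hR
  obtain ⟨hk, hk'⟩ := coeff_of_order hQ hS
  have hm5 : m ≤ 5 := by
    by_contra! hlt
    exact hm (coeff_topForm_eq_zero hlt)
  have hm0 : m ≠ 0 := by
    rintro rfl
    rw [coeff_topForm (by norm_num)] at hm
    exact hm h0
  obtain ⟨rfl, rfl⟩ : m = 5 ∧ k = 6 := by omega
  rw [coeff_topForm le_rfl] at hm hk
  refine injective_of_top_pow hJ (fun i j hij ↦ ?_) (fun i j hij ↦ ?_) hm hk
  · have := hF i j hij
    by_contra! hcon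
    have h1 := hm' i (by omega)
    rw [coeff_topForm (by omega), show 5 - i = j by omega] at h1
    exact hij h1
  · have := hG i j hij
    by_contra! hcon
    have h1 := hk' i (by omega)
    rw [coeff_topForm (by omega), show 6 - i = j by omega] at h1
    exact hij h1

/-- A form of odd degree vanishes in some direction. -/
lemma exists_angle (F : ℕ → ℝ[X]) : ∃ θ : ℝ, lead F 1 1 5 (Real.cos θ) (Real.sin θ) = 0 := by
  have hcont : Continuous fun θ : ℝ ↦ lead F 1 1 5 (Real.cos θ) (Real.sin θ) := by
    unfold lead
    refine continuous_finsetSum _ fun j _ ↦ continuous_finsetSum _ fun i _ ↦ ?_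
    split_ifs <;> fun_prop
  have hπ : lead F 1 1 5 (Real.cos Real.pi) (Real.sin Real.pi)
      = -lead F 1 1 5 (Real.cos 0) (Real.sin 0) := by
    simp [lead, Finset.sum_range_succ]
    norm_num
  rcases le_total (lead F 1 1 5 (Real.cos 0) (Real.sin 0)) 0 with h | h
  · exact mem_range_of_exists_le_of_exists_ge hcont ⟨0, h⟩ ⟨Real.pi, by rw [hπ]; linarith⟩
  · exact mem_range_of_exists_le_of_exists_ge hcont ⟨Real.pi, by rw [hπ]; linarith⟩ ⟨0, h⟩

lemma exists_coeff_array_ne_zero {f : MvPolynomial (Fin 2) ℝ} {n : ℕ} (hn : n ≠ 0)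
    (hf : f.totalDegree = n) : ∃ i j, i + j = n ∧ (array f j).coeff i ≠ 0 := by
  by_contra! hcon
  have : f.totalDegree ≤ n - 1 := by
    refine Finset.sup_le fun d hd ↦ ?_
    have hle := le_totalDegree hd
    rw [Finsupp.sum_fintype _ _ fun _ ↦ rfl, Fin.sum_univ_two] at hle ⊢
    by_contra! hlt
    have := hcon (d 0) (d 1) (by omega)
    rw [coeff_array] at this
    have e : Finsupp.single 0 (d 0) + Finsupp.single 1 (d 1) = d := by
      ext k
      fin_cases k <;> simp
    rw [e] at this
    exact mem_support_iff.mp hd this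
  omega

theorem injective_of_pos {f g : MvPolynomial (Fin 2) ℝ} (hf : f.totalDegree = 5)
    (hg : g.totalDegree = 6) (hJ : ∀ p : Fin 2 → ℝ, 0 < eval p (Jac f g)) :
    Function.Injective (fun p : Fin 2 → ℝ => (eval p f, eval p g)) := by
  obtain ⟨θ, hθ⟩ := exists_angle (array f)
  set c := Real.cos θ
  set s := Real.sin θ
  have hcs : s * s - c * -c = 1 := by linarith [Real.sin_sq_add_cos_sq θ]
  have hf' := totalDegree_linSubst hcs f
  have hg' := totalDegree_linSubst hcs g
  set f' := linSubst s c (-c) s f with hf'_def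
  set g' := linSubst s c (-c) s g with hg'_def
  rw [hf] at hf'
  rw [hg] at hg'
  have sF := supp_array hf.le
  have sG := supp_array hg.le
  have sF' := supp_array hf'.le
  have sG' := supp_array hg'.le
  have bF : ∀ x y, bi (array f') x y = bi (array f) (s * x + c * y) (-c * x + s * y) :=
    fun x y ↦ by
      rw [bi_array (sF'.mono (by omega)), bi_array (sF.mono (by omega)), hf'_def, eval_linSubst]
  have bG : ∀ x y, bi (array g') x y = bi (array g) (s * x + c * y) (-c * x + s * y) :=
    fun x y ↦ by
      rw [bi_array (sG'.mono (by omega)), bi_array (sG.mono (by omega)), hg'_def, eval_linSubst]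
  have hJ' : ∀ x y, 0 < jac (array f') (array g') x y := fun x y ↦ by
    have h1 := bi_partial_comp (sF.mono (by omega)) (sF'.mono (by omega)) bF x y
    have h2 := bi_partial_comp sG sG' bG x y
    have h3 := hJ ![s * x + c * y, -c * x + s * y]
    rw [← jac_array (by omega) (by omega), jac] at h3
    rw [jac, h1.1, h1.2, h2.1, h2.2]
    refine h3.trans_eq ?_
    linear_combination -(bi (dx (array f)) (s * x + c * y) (-c * x + s * y) *
      bi (dy (array g)) (s * x + c * y) (-c * x + s * y) -
      bi (dy (array f)) (s * x + c * y) (-c * x + s * y) *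
      bi (dx (array g)) (s * x + c * y) (-c * x + s * y)) * hcs
  have h05 : (array f' 5).coeff 0 = 0 := by
    have h1 := lead_comp (n := 5) (by norm_num) sF sF' bF 0 1
    have h2 : lead (array f') 1 1 5 0 1 = (array f' 5).coeff 0 := by
      simp [lead, Finset.sum_range_succ]
    rw [← h2]
    simpa [hθ] using h1
  have hinj := injective_of_top hJ' sF' sG' h05 (exists_coeff_array_ne_zero (by norm_num) hf')
    (exists_coeff_array_ne_zero (by norm_num) hg')
  have hcoord : ∀ p : Fin 2 → ℝ, p = ![s * (s * p 0 - c * p 1) + c * (c * p 0 + s * p 1),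
      -c * (s * p 0 - c * p 1) + s * (c * p 0 + s * p 1)] := fun p ↦ by
    ext k
    fin_cases k
    · simp
      linear_combination -p 0 * hcs
    · simp
      linear_combination -p 1 * hcs
  have key : ∀ p : Fin 2 → ℝ, toMap (array f') (array g') (s * p 0 - c * p 1, c * p 0 + s * p 1) =
      (eval p f, eval p g) := fun p ↦ by
    rw [toMap, bF, bG, bi_array (sF.mono (by omega)), bi_array (sG.mono (by omega))]
    conv_rhs => rw [hcoord p]
  intro p q hpq
  have h1 := hinj ((key p).trans (hpq.trans (key q).symm))
  rw [Prod.mk.injEq] at h1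
  rw [hcoord p, hcoord q, h1.1, h1.2]

end RealJacobian

theorem real_jacobian_deg_five_six (f g : MvPolynomial (Fin 2) ℝ)
    (hf : f.totalDegree = 5) (hg : g.totalDegree = 6)
    (hJ : ∀ p : Fin 2 → ℝ, eval p (Jac f g) ≠ 0) :
    Function.Injective (fun p : Fin 2 → ℝ => (eval p f, eval p g)) := by
  have hcont : Continuous fun p : Fin 2 → ℝ => eval p (Jac f g) := continuous_eval _
  have hzero : ¬ ∃ p : Fin 2 → ℝ, eval p (Jac f g) = 0 := fun ⟨p, hp⟩ ↦ hJ p hp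
  by_cases hpos : ∀ p : Fin 2 → ℝ, 0 < eval p (Jac f g)
  · exact RealJacobian.injective_of_pos hf hg hpos
  · push Not at hpos
    have hneg : ∀ p : Fin 2 → ℝ, eval p (Jac f g) < 0 := fun p ↦ by
      by_contra! hp
      exact hzero (mem_range_of_exists_le_of_exists_ge hcont hpos ⟨p, hp⟩)
    have hinj := RealJacobian.injective_of_pos hf (g := -g) (by rwa [totalDegree_neg]) fun p ↦ by
      have := hneg p
      simp only [Jac, map_sub, map_mul, map_neg] at this ⊢
      linarith
    intro p q hpq
    simp only [Prod.mk.injEq] at hpq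
    exact hinj (by simp [hpq.1, hpq.2])
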